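/- arXiv:2010.14593 — 2 statements merged into one kernel-verified Lean document; each statement's English description precedes it below -/
import Mathlib

section
/- Let Z be a C*-ternary ring. Then the bidual Z″, equipped with the bidual norm and the Arens extension of the triple product of Z, is again a C*-ternary ring: the extended product is linear in the outer variables and conjugate-linear in the middle variable, associative in the sense that [[V W X] Y U] = [V [Y X W] U] = [V W [X Y U]] for all U,V,W,X,Y ∈ Z″, and satisfies ‖[H G F]‖ ≤ ‖H‖‖G‖‖F‖ and ‖[F F F]‖ = ‖F‖³ for all F, G, H ∈ Z″. -/
set_option maxSynthPendingDepth 2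

noncomputable section

open ContinuousLinearMap

variable {A B C D : Type*}
  [NormedAddCommGroup A] [NormedSpace ℂ A]
  [NormedAddCommGroup B] [NormedSpace ℂ B]
  [NormedAddCommGroup C] [NormedSpace ℂ C]
  [NormedAddCommGroup D] [NormedSpace ℂ D]

/-- Evaluation at a vector, for spaces of conjugate-linear continuous maps. -/
def evalSL (g : B) : (B →SL[starRingEnd ℂ] D) →L[ℂ] D :=
  LinearMap.mkContinuous
    { toFun := fun v => v g
      map_add' := fun _ _ => rfl
      map_smul' := fun _ _ => rfl }
    ‖g‖ (fun v => by rw [mul_comm]; exact v.le_opNorm g)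

@[simp] lemma evalSL_apply (g : B) (v : B →SL[starRingEnd ℂ] D) : evalSL g v = v g := rfl

/-- Evaluation at a vector, for spaces of linear continuous maps. -/
def evalL (f : A) : (A →L[ℂ] D) →L[ℂ] D :=
  LinearMap.mkContinuous
    { toFun := fun v => v f
      map_add' := fun _ _ => rfl
      map_smul' := fun _ _ => rfl }
    ‖f‖ (fun v => by rw [mul_comm]; exact v.le_opNorm f)

@[simp] lemma evalL_apply (f : A) (v : A →L[ℂ] D) : evalL f v = v f := rfl

/-- `μ₀(f',f,g) ∈ C′`, `⟨μ₀(f',f,g), h⟩ = ⟨f', [h g f]⟩`. -/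
def mu0 (t : C →L[ℂ] B →SL[starRingEnd ℂ] (A →L[ℂ] D))
    (f' : D →L[ℂ] ℂ) (f : A) (g : B) : C →L[ℂ] ℂ :=
  f'.comp ((evalL f).comp ((evalSL g).comp t))

@[simp] lemma mu0_apply (t : C →L[ℂ] B →SL[starRingEnd ℂ] (A →L[ℂ] D))
    (f' : D →L[ℂ] ℂ) (f : A) (g : B) (h : C) : mu0 t f' f g h = f' (t h g f) := rfl

lemma mu0_norm_le (t : C →L[ℂ] B →SL[starRingEnd ℂ] (A →L[ℂ] D))
    (f' : D →L[ℂ] ℂ) (f : A) (g : B) :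
    ‖mu0 t f' f g‖ ≤ ‖f'‖ * ‖t‖ * ‖f‖ * ‖g‖ := by
  refine opNorm_le_bound _ (by positivity) fun h => ?_
  calc ‖mu0 t f' f g h‖ = ‖f' (t h g f)‖ := rfl
    _ ≤ ‖f'‖ * ‖t h g f‖ := f'.le_opNorm _
    _ ≤ ‖f'‖ * (‖t h g‖ * ‖f‖) := by gcongr; exact (t h g).le_opNorm f
    _ ≤ ‖f'‖ * ((‖t h‖ * ‖g‖) * ‖f‖) := by gcongr; exact (t h).le_opNorm g
    _ ≤ ‖f'‖ * (((‖t‖ * ‖h‖) * ‖g‖) * ‖f‖) := by gcongr; exact t.le_opNorm h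
    _ = ‖f'‖ * ‖t‖ * ‖f‖ * ‖g‖ * ‖h‖ := by ring

variable (t : C →L[ℂ] B →SL[starRingEnd ℂ] (A →L[ℂ] D))

lemma mu0_add_g (f' : D →L[ℂ] ℂ) (f : A) (g₁ g₂ : B) :
    mu0 t f' f (g₁ + g₂) = mu0 t f' f g₁ + mu0 t f' f g₂ := by
  ext h; simp

lemma mu0_smul_g (f' : D →L[ℂ] ℂ) (f : A) (c : ℂ) (g : B) :
    mu0 t f' f (c • g) = (starRingEnd ℂ) c • mu0 t f' f g := by
  ext h; simp [ContinuousLinearMap.map_smulₛₗ]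

lemma mu0_add_f (f' : D →L[ℂ] ℂ) (f₁ f₂ : A) (g : B) :
    mu0 t f' (f₁ + f₂) g = mu0 t f' f₁ g + mu0 t f' f₂ g := by
  ext h; simp

lemma mu0_smul_f (f' : D →L[ℂ] ℂ) (c : ℂ) (f : A) (g : B) :
    mu0 t f' (c • f) g = c • mu0 t f' f g := by
  ext h; simp

lemma mu0_add_f' (f'₁ f'₂ : D →L[ℂ] ℂ) (f : A) (g : B) :
    mu0 t (f'₁ + f'₂) f g = mu0 t f'₁ f g + mu0 t f'₂ f g := by
  ext h; simp

lemma mu0_smul_f' (c : ℂ) (f' : D →L[ℂ] ℂ) (f : A) (g : B) :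
    mu0 t (c • f') f g = c • mu0 t f' f g := by
  ext h; simp

/-- `μ₁(H,f',f) ∈ B′`, `⟨μ₁(H,f',f), g⟩ = conj ⟨H, μ₀(f',f,g)⟩`. -/
def mu1 (H : (C →L[ℂ] ℂ) →L[ℂ] ℂ) (f' : D →L[ℂ] ℂ) (f : A) : B →L[ℂ] ℂ :=
  LinearMap.mkContinuous
    { toFun := fun g => (starRingEnd ℂ) (H (mu0 t f' f g))
      map_add' := fun g₁ g₂ => by simp [mu0_add_g]
      map_smul' := fun c g => by simp [mu0_smul_g, smul_eq_mul] }
    (‖H‖ * (‖f'‖ * ‖t‖ * ‖f‖))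
    (fun g => by
      have h1 : ‖H (mu0 t f' f g)‖ ≤ ‖H‖ * ‖mu0 t f' f g‖ := H.le_opNorm _
      have h2 : ‖H‖ * ‖mu0 t f' f g‖ ≤ ‖H‖ * (‖f'‖ * ‖t‖ * ‖f‖ * ‖g‖) := by
        gcongr
        exact mu0_norm_le t f' f g
      calc ‖(starRingEnd ℂ) (H (mu0 t f' f g))‖ = ‖H (mu0 t f' f g)‖ := by
            simp
        _ ≤ ‖H‖ * (‖f'‖ * ‖t‖ * ‖f‖ * ‖g‖) := le_trans h1 h2
        _ = ‖H‖ * (‖f'‖ * ‖t‖ * ‖f‖) * ‖g‖ := by ring)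

@[simp] lemma mu1_apply (H : (C →L[ℂ] ℂ) →L[ℂ] ℂ) (f' : D →L[ℂ] ℂ) (f : A) (g : B) :
    mu1 t H f' f g = (starRingEnd ℂ) (H (mu0 t f' f g)) := rfl

lemma mu1_norm_le (H : (C →L[ℂ] ℂ) →L[ℂ] ℂ) (f' : D →L[ℂ] ℂ) (f : A) :
    ‖mu1 t H f' f‖ ≤ ‖H‖ * (‖f'‖ * ‖t‖ * ‖f‖) :=
  LinearMap.mkContinuous_norm_le _ (by positivity) _

lemma mu1_add_f (H : (C →L[ℂ] ℂ) →L[ℂ] ℂ) (f' : D →L[ℂ] ℂ) (f₁ f₂ : A) :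
    mu1 t H f' (f₁ + f₂) = mu1 t H f' f₁ + mu1 t H f' f₂ := by
  ext g; simp [mu0_add_f]

lemma mu1_smul_f (H : (C →L[ℂ] ℂ) →L[ℂ] ℂ) (f' : D →L[ℂ] ℂ) (c : ℂ) (f : A) :
    mu1 t H f' (c • f) = (starRingEnd ℂ) c • mu1 t H f' f := by
  ext g; simp [mu0_smul_f, smul_eq_mul]

lemma mu1_add_f' (H : (C →L[ℂ] ℂ) →L[ℂ] ℂ) (f'₁ f'₂ : D →L[ℂ] ℂ) (f : A) :
    mu1 t H (f'₁ + f'₂) f = mu1 t H f'₁ f + mu1 t H f'₂ f := by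
  ext g; simp [mu0_add_f']

lemma mu1_smul_f' (H : (C →L[ℂ] ℂ) →L[ℂ] ℂ) (c : ℂ) (f' : D →L[ℂ] ℂ) (f : A) :
    mu1 t H (c • f') f = (starRingEnd ℂ) c • mu1 t H f' f := by
  ext g; simp [mu0_smul_f', smul_eq_mul]


/-- `μ₂(G,H,f') ∈ A′`, `⟨μ₂(G,H,f'), f⟩ = conj ⟨G, μ₁(H,f',f)⟩`. -/
def mu2 (G : (B →L[ℂ] ℂ) →L[ℂ] ℂ) (H : (C →L[ℂ] ℂ) →L[ℂ] ℂ) (f' : D →L[ℂ] ℂ) :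
    A →L[ℂ] ℂ :=
  LinearMap.mkContinuous
    { toFun := fun f => (starRingEnd ℂ) (G (mu1 t H f' f))
      map_add' := fun f₁ f₂ => by simp [mu1_add_f]
      map_smul' := fun c f => by simp [mu1_smul_f, smul_eq_mul] }
    (‖G‖ * (‖H‖ * (‖f'‖ * ‖t‖)))
    (fun f => by
      have h1 : ‖G (mu1 t H f' f)‖ ≤ ‖G‖ * ‖mu1 t H f' f‖ := G.le_opNorm _
      have h2 : ‖G‖ * ‖mu1 t H f' f‖ ≤ ‖G‖ * (‖H‖ * (‖f'‖ * ‖t‖ * ‖f‖)) := by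
        gcongr
        exact mu1_norm_le t H f' f
      calc ‖(starRingEnd ℂ) (G (mu1 t H f' f))‖ = ‖G (mu1 t H f' f)‖ := by simp
        _ ≤ ‖G‖ * (‖H‖ * (‖f'‖ * ‖t‖ * ‖f‖)) := le_trans h1 h2
        _ = ‖G‖ * (‖H‖ * (‖f'‖ * ‖t‖)) * ‖f‖ := by ring)

@[simp] lemma mu2_apply (G : (B →L[ℂ] ℂ) →L[ℂ] ℂ) (H : (C →L[ℂ] ℂ) →L[ℂ] ℂ)
    (f' : D →L[ℂ] ℂ) (f : A) :
    mu2 t G H f' f = (starRingEnd ℂ) (G (mu1 t H f' f)) := rfl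

lemma mu2_norm_le (G : (B →L[ℂ] ℂ) →L[ℂ] ℂ) (H : (C →L[ℂ] ℂ) →L[ℂ] ℂ) (f' : D →L[ℂ] ℂ) :
    ‖mu2 t G H f'‖ ≤ ‖G‖ * (‖H‖ * (‖f'‖ * ‖t‖)) :=
  LinearMap.mkContinuous_norm_le _ (by positivity) _

lemma mu2_add_f' (G : (B →L[ℂ] ℂ) →L[ℂ] ℂ) (H : (C →L[ℂ] ℂ) →L[ℂ] ℂ)
    (f'₁ f'₂ : D →L[ℂ] ℂ) :
    mu2 t G H (f'₁ + f'₂) = mu2 t G H f'₁ + mu2 t G H f'₂ := by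
  ext f; simp [mu1_add_f']

lemma mu2_smul_f' (G : (B →L[ℂ] ℂ) →L[ℂ] ℂ) (H : (C →L[ℂ] ℂ) →L[ℂ] ℂ)
    (c : ℂ) (f' : D →L[ℂ] ℂ) :
    mu2 t G H (c • f') = c • mu2 t G H f' := by
  ext f; simp [mu1_smul_f', smul_eq_mul]

/-- The Arens extension `t″ : C″ × B″ × A″ → D″` of the bounded trilinear map `t`,
written `[H G F]`; `⟨[H G F], f'⟩ = ⟨F, μ₂(G,H,f')⟩`. -/
def arens3 (H : (C →L[ℂ] ℂ) →L[ℂ] ℂ) (G : (B →L[ℂ] ℂ) →L[ℂ] ℂ)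
    (F : (A →L[ℂ] ℂ) →L[ℂ] ℂ) : (D →L[ℂ] ℂ) →L[ℂ] ℂ :=
  LinearMap.mkContinuous
    { toFun := fun f' => F (mu2 t G H f')
      map_add' := fun f'₁ f'₂ => by simp [mu2_add_f']
      map_smul' := fun c f' => by simp [mu2_smul_f'] }
    (‖F‖ * (‖G‖ * (‖H‖ * ‖t‖)))
    (fun f' => by
      have h1 : ‖F (mu2 t G H f')‖ ≤ ‖F‖ * ‖mu2 t G H f'‖ := F.le_opNorm _
      have h2 : ‖F‖ * ‖mu2 t G H f'‖ ≤ ‖F‖ * (‖G‖ * (‖H‖ * (‖f'‖ * ‖t‖))) := by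
        gcongr
        exact mu2_norm_le t G H f'
      calc ‖F (mu2 t G H f')‖ ≤ ‖F‖ * (‖G‖ * (‖H‖ * (‖f'‖ * ‖t‖))) := le_trans h1 h2
        _ = ‖F‖ * (‖G‖ * (‖H‖ * ‖t‖)) * ‖f'‖ := by ring)

@[simp] lemma arens3_apply (H : (C →L[ℂ] ℂ) →L[ℂ] ℂ) (G : (B →L[ℂ] ℂ) →L[ℂ] ℂ)
    (F : (A →L[ℂ] ℂ) →L[ℂ] ℂ) (f' : D →L[ℂ] ℂ) :
    arens3 t H G F f' = F (mu2 t G H f') := rfl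

section Adjointable

variable {Z : Type*} [NormedAddCommGroup Z] [NormedSpace ℂ Z]

/-- The axioms of a C*-ternary ring, for a bounded triple product. -/
class IsCStarTernary (T : Z →L[ℂ] Z →SL[starRingEnd ℂ] (Z →L[ℂ] Z)) : Prop where
  assoc_mid : ∀ v w x y z : Z, T (T v w x) y z = T v (T y x w) z
  assoc_right : ∀ v w x y z : Z, T (T v w x) y z = T v w (T x y z)
  norm_le : ∀ x y z : Z, ‖T x y z‖ ≤ ‖x‖ * ‖y‖ * ‖z‖
  norm_cube : ∀ x : Z, ‖T x x x‖ = ‖x‖ ^ 3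

/-- The triple product with the two outer variables exchanged. -/
def ternaryFlip (T : Z →L[ℂ] Z →SL[starRingEnd ℂ] (Z →L[ℂ] Z)) :
    Z →L[ℂ] Z →SL[starRingEnd ℂ] (Z →L[ℂ] Z) :=
  ContinuousLinearMap.flip
    (((flipₗᵢ ℂ Z Z Z).toContinuousLinearEquiv : (Z →L[ℂ] Z →L[ℂ] Z) →L[ℂ] _).comp
      (ContinuousLinearMap.flip T))

@[simp] lemma ternaryFlip_apply (T : Z →L[ℂ] Z →SL[starRingEnd ℂ] (Z →L[ℂ] Z)) (x y z : Z) :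
    ternaryFlip T x y z = T z y x := rfl

instance (T : Z →L[ℂ] Z →SL[starRingEnd ℂ] (Z →L[ℂ] Z)) [h : IsCStarTernary T] :
    IsCStarTernary (ternaryFlip T) where
  assoc_mid v w x y z := by
    simp only [ternaryFlip_apply]
    rw [← h.assoc_right, h.assoc_mid]
  assoc_right v w x y z := by
    simp only [ternaryFlip_apply]
    rw [← h.assoc_right]
  norm_le x y z := by
    simp only [ternaryFlip_apply]
    calc _ ≤ _ := h.norm_le z y x
      _ = _ := by ring
  norm_cube x := h.norm_cube x

/-- `a` and `b` are mutually adjoint operators with respect to the left structure of a triple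
product. -/
structure IsTernaryAdjoint (T : Z →L[ℂ] Z →SL[starRingEnd ℂ] (Z →L[ℂ] Z)) (a b : Z →L[ℂ] Z) :
    Prop where
  left : ∀ x y z, T (a x) y z = a (T x y z)
  mid : ∀ x y z, T x (a y) z = T x y (b z)
  left' : ∀ x y z, T (b x) y z = b (T x y z)
  mid' : ∀ x y z, T x (b y) z = T x y (a z)

variable {T : Z →L[ℂ] Z →SL[starRingEnd ℂ] (Z →L[ℂ] Z)}

namespace IsTernaryAdjoint

lemma symm {a b : Z →L[ℂ] Z} (h : IsTernaryAdjoint T a b) : IsTernaryAdjoint T b a :=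
  ⟨h.left', h.mid', h.left, h.mid⟩

lemma add {a b a' b' : Z →L[ℂ] Z} (h : IsTernaryAdjoint T a b) (h' : IsTernaryAdjoint T a' b') :
    IsTernaryAdjoint T (a + a') (b + b') := by
  constructor <;> intro x y z <;>
    simp [h.left, h'.left, h.mid, h'.mid, h.left', h'.left', h.mid', h'.mid']

lemma smul {a b : Z →L[ℂ] Z} (h : IsTernaryAdjoint T a b) (c : ℂ) :
    IsTernaryAdjoint T (c • a) (star c • b) := by
  constructor <;> intro x y z <;>
    simp [h.left, h.mid, h.left', h.mid', ContinuousLinearMap.map_smulₛₗ]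

lemma mul {a b a' b' : Z →L[ℂ] Z} (h : IsTernaryAdjoint T a b) (h' : IsTernaryAdjoint T a' b') :
    IsTernaryAdjoint T (a * a') (b' * b) := by
  constructor <;> intro x y z <;>
    simp [h.left, h'.left, h.mid, h'.mid, h.left', h'.left', h.mid', h'.mid']

lemma one : IsTernaryAdjoint T 1 1 := by
  constructor <;> intro x y z <;> simp

lemma unique [hT : IsCStarTernary T] {a b b' : Z →L[ℂ] Z} (h : IsTernaryAdjoint T a b)
    (h' : IsTernaryAdjoint T a b') : b = b' := by
  ext u
  have key : T (b u - b' u) (b u - b' u) (b u - b' u) = 0 := by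
    rw [map_sub (T (b u - b' u) (b u - b' u)), ← h.mid, ← h'.mid, sub_self]
  have := hT.norm_cube (b u - b' u)
  rw [key, norm_zero] at this
  exact sub_eq_zero.mp (norm_eq_zero.mp (pow_eq_zero_iff (by norm_num) |>.mp this.symm))

lemma norm_sq_le [hT : IsCStarTernary T] {a b : Z →L[ℂ] Z} (h : IsTernaryAdjoint T a b) :
    ‖a‖ * ‖a‖ ≤ ‖b * a‖ := by
  have key : ∀ z, ‖a z‖ ^ 3 ≤ ‖a‖ * ‖b * a‖ * ‖z‖ ^ 3 := fun z => by
    rw [← hT.norm_cube, h.left, h.mid]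
    calc ‖a (T z z (b (a z)))‖ ≤ ‖a‖ * (‖z‖ * ‖z‖ * (‖b * a‖ * ‖z‖)) := by
          refine (a.le_opNorm _).trans ?_
          gcongr
          refine (hT.norm_le _ _ _).trans ?_
          gcongr
          exact (b * a).le_opNorm z
      _ = _ := by ring
  have h3 : ‖a‖ ^ 3 ≤ ‖a‖ * ‖b * a‖ := by
    set m : ℝ := (‖a‖ * ‖b * a‖) ^ (1 / 3 : ℝ) with hm
    have hm0 : 0 ≤ m := by positivity
    have hm3 : m ^ 3 = ‖a‖ * ‖b * a‖ := by
      rw [hm, ← Real.rpow_natCast, ← Real.rpow_mul (by positivity)]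
      norm_num
    rw [← hm3]
    gcongr
    refine opNorm_le_bound _ hm0 fun z => ?_
    have := key z
    rw [← hm3, ← mul_pow] at this
    exact le_of_pow_le_pow_left₀ (by norm_num) (by positivity) this
  rcases (norm_nonneg a).eq_or_lt with h0 | h0
  · rw [← h0]; simp
  · nlinarith

lemma norm_eq [hT : IsCStarTernary T] {a b : Z →L[ℂ] Z} (h : IsTernaryAdjoint T a b) :
    ‖a‖ = ‖b‖ := by
  have aux : ∀ {a b : Z →L[ℂ] Z}, IsTernaryAdjoint T a b → ‖a‖ ≤ ‖b‖ := fun {a b} h => by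
    rcases (norm_nonneg a).eq_or_lt with h0 | h0
    · rw [← h0]; positivity
    · exact le_of_mul_le_mul_right (h.norm_sq_le.trans (norm_mul_le b a)) h0
  exact le_antisymm (aux h) (aux h.symm)

end IsTernaryAdjoint

variable (T)

/-- The algebra of operators on `Z` that are adjointable for the left structure of `T`. -/
def adjointable : Subalgebra ℂ (Z →L[ℂ] Z) where
  carrier := {a | ∃ b, IsTernaryAdjoint T a b}
  mul_mem' := fun ⟨_, h⟩ ⟨_, h'⟩ => ⟨_, h.mul h'⟩
  add_mem' := fun ⟨_, h⟩ ⟨_, h'⟩ => ⟨_, h.add h'⟩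
  algebraMap_mem' c := ⟨_, by simpa [Algebra.algebraMap_eq_smul_one] using IsTernaryAdjoint.one.smul c⟩

variable {T}

/-- The adjoint of an adjointable operator. -/
instance : Star (adjointable T) := ⟨fun a => ⟨a.2.choose, a, a.2.choose_spec.symm⟩⟩

lemma adjointable_pair (a : adjointable T) :
    IsTernaryAdjoint T (a : Z →L[ℂ] Z) (star a : adjointable T) := a.2.choose_spec

lemma adjointable_star_eq [IsCStarTernary T] {a b : adjointable T}
    (h : IsTernaryAdjoint T (a : Z →L[ℂ] Z) b) : star a = b :=
  Subtype.ext ((adjointable_pair a).unique h)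

instance [IsCStarTernary T] : StarRing (adjointable T) where
  star_involutive a := adjointable_star_eq (adjointable_pair a).symm
  star_mul a b := adjointable_star_eq ((adjointable_pair a).mul (adjointable_pair b))
  star_add a b := adjointable_star_eq ((adjointable_pair a).add (adjointable_pair b))

instance [IsCStarTernary T] : StarModule ℂ (adjointable T) where
  star_smul c a := adjointable_star_eq ((adjointable_pair a).smul c)

instance [IsCStarTernary T] : CStarRing (adjointable T) where
  norm_mul_self_le a := (adjointable_pair a).norm_sq_le

lemma isClosed_adjointable [CompleteSpace Z] [IsCStarTernary T] :
    IsClosed (adjointable T : Set (Z →L[ℂ] Z)) := by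
  refine isClosed_of_closure_subset fun a ha => ?_
  obtain ⟨u, hu, hua⟩ := mem_closure_iff_seq_limit.mp ha
  have hpair (n) : IsTernaryAdjoint T (u n) (star (⟨u n, hu n⟩ : adjointable T) : adjointable T) :=
    adjointable_pair ⟨u n, hu n⟩
  generalize hv : (fun n => ((star (⟨u n, hu n⟩ : adjointable T) : adjointable T) : Z →L[ℂ] Z)) = v
  replace hpair (n) : IsTernaryAdjoint T (u n) (v n) := hv ▸ hpair n
  have hcauchy : CauchySeq v := by
    rw [Metric.cauchySeq_iff]
    intro ε hε
    obtain ⟨N, hN⟩ := Metric.cauchySeq_iff.mp hua.cauchySeq ε hε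
    refine ⟨N, fun m hm n hn => ?_⟩
    have h : ‖u m - u n‖ = ‖v m - v n‖ := by
      simpa [sub_eq_add_neg] using ((hpair m).add ((hpair n).smul (-1))).norm_eq
    rw [dist_eq_norm, ← h, ← dist_eq_norm]
    exact hN m hm n hn
  obtain ⟨b, hb⟩ := cauchySeq_tendsto_of_complete hcauchy
  have ev {w : ℕ → Z →L[ℂ] Z} {c : Z →L[ℂ] Z} (h : Filter.Tendsto w Filter.atTop (nhds c)) (z : Z) :
      Filter.Tendsto (fun n => w n z) Filter.atTop (nhds (c z)) :=
    ((ContinuousLinearMap.apply ℂ Z z).continuous.tendsto c).comp h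
  have lf (y z : Z) : Continuous fun x => T x y z := by fun_prop
  have mf (x z : Z) : Continuous fun y => T x y z := by fun_prop
  have rf (x y : Z) : Continuous fun z => T x y z := by fun_prop
  have main {u v : ℕ → Z →L[ℂ] Z} {a b : Z →L[ℂ] Z}
      (hua : Filter.Tendsto u Filter.atTop (nhds a)) (hvb : Filter.Tendsto v Filter.atTop (nhds b))
      (hp : ∀ n, IsTernaryAdjoint T (u n) (v n)) :
      (∀ x y z, T (a x) y z = a (T x y z)) ∧ (∀ x y z, T x (a y) z = T x y (b z)) := by
    refine ⟨fun x y z => ?_, fun x y z => ?_⟩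
    · refine tendsto_nhds_unique (((lf y z).tendsto _).comp (ev hua x)) ?_
      refine (ev hua (T x y z)).congr fun n => ((hp n).left x y z).symm
    · refine tendsto_nhds_unique (((mf x z).tendsto _).comp (ev hua y)) ?_
      refine (((rf x y).tendsto _).comp (ev hvb z)).congr fun n => ((hp n).mid x y z).symm
  obtain ⟨h1, h2⟩ := main hua hb hpair
  obtain ⟨h3, h4⟩ := main hb hua fun n => (hpair n).symm
  exact ⟨b, h1, h2, h3, h4⟩

instance [CompleteSpace Z] [IsCStarTernary T] : CompleteSpace (adjointable T) :=
  isClosed_adjointable.completeSpace_coe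

instance [CompleteSpace Z] [IsCStarTernary T] : CStarAlgebra (adjointable T) where

instance [CompleteSpace Z] [IsCStarTernary T] : PartialOrder (adjointable T) :=
  CStarAlgebra.spectralOrder _

instance [CompleteSpace Z] [IsCStarTernary T] : StarOrderedRing (adjointable T) :=
  CStarAlgebra.spectralOrderedRing _

end Adjointable

section Spectrum

variable {𝒜 ℬ : Type*} [CStarAlgebra 𝒜] [PartialOrder 𝒜] [StarOrderedRing 𝒜]
  [CStarAlgebra ℬ] [PartialOrder ℬ] [StarOrderedRing ℬ]

lemma nonneg_of_spectrum_subset {a : 𝒜} {b : ℬ} (ha : IsSelfAdjoint a) (hb : IsSelfAdjoint b)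
    (h : ∀ s : ℝ, s ≠ 0 → s ∈ spectrum ℝ b → s ∈ spectrum ℝ a) (h0 : 0 ≤ a) : 0 ≤ b := by
  rw [StarOrderedRing.nonneg_iff_spectrum_nonneg (R := ℝ) _ ha] at h0
  rw [StarOrderedRing.nonneg_iff_spectrum_nonneg (R := ℝ) _ hb]
  intro s hs
  rcases eq_or_ne s 0 with rfl | hs0
  · exact le_rfl
  · exact h0 s (h s hs0 hs)

lemma nonpos_of_spectrum_subset {a : 𝒜} {b : ℬ} (ha : IsSelfAdjoint a) (hb : IsSelfAdjoint b)
    (h : ∀ s : ℝ, s ≠ 0 → s ∈ spectrum ℝ b → s ∈ spectrum ℝ a) (h0 : a ≤ 0) : b ≤ 0 := by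
  refine neg_nonneg.mp (nonneg_of_spectrum_subset ha.neg hb.neg (fun s hs hs' => ?_)
    (neg_nonneg.mpr h0))
  rw [← spectrum.neg_eq, Set.mem_neg] at hs' ⊢
  exact h _ (neg_ne_zero.mpr hs) hs'

end Spectrum

section LeftOperators

variable {Z : Type*} [NormedAddCommGroup Z] [NormedSpace ℂ Z]
  (T : Z →L[ℂ] Z →SL[starRingEnd ℂ] (Z →L[ℂ] Z))

lemma isTernaryAdjoint_leftMul [h : IsCStarTernary T] (x y : Z) :
    IsTernaryAdjoint T (T x y) (T y x) := by
  have key : ∀ x y, (∀ u v w, T (T x y u) v w = T x y (T u v w)) ∧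
      (∀ u v w, T u (T x y v) w = T u v (T y x w)) := fun x y =>
    ⟨fun u v w => h.assoc_right _ _ _ _ _, fun u v w => by rw [← h.assoc_mid, h.assoc_right]⟩
  exact ⟨(key x y).1, (key x y).2, (key y x).1, (key y x).2⟩

/-- Left multiplications `z ↦ [x y z]`, as adjointable operators. -/
def leftMul [IsCStarTernary T] : Z →ₗ[ℂ] Z →ₗ⋆[ℂ] adjointable T :=
  LinearMap.mk₂'ₛₗ (RingHom.id ℂ) (starRingEnd ℂ)
    (fun x y => ⟨T x y, _, isTernaryAdjoint_leftMul T x y⟩)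
    (fun _ _ _ => Subtype.ext (by simp)) (fun _ _ _ => Subtype.ext (by simp))
    (fun _ _ _ => Subtype.ext (by simp))
    (fun _ _ _ => Subtype.ext (by simp [ContinuousLinearMap.map_smulₛₗ]))

variable {T}

lemma norm_adjointable_apply_le (a : adjointable T) (x : Z) : ‖(a : Z →L[ℂ] Z) x‖ ≤ ‖a‖ * ‖x‖ :=
  (a : Z →L[ℂ] Z).le_opNorm x

variable [IsCStarTernary T]

@[simp] lemma leftMul_apply (x y z : Z) : (leftMul T x y : Z →L[ℂ] Z) z = T x y z := rfl

lemma star_leftMul (x y : Z) : star (leftMul T x y) = leftMul T y x :=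
  adjointable_star_eq (isTernaryAdjoint_leftMul T x y)

lemma mul_leftMul (a : adjointable T) (x y : Z) :
    a * leftMul T x y = leftMul T ((a : Z →L[ℂ] Z) x) y := by
  ext z
  exact ((adjointable_pair a).left x y z).symm

lemma leftMul_mul (a : adjointable T) (x y : Z) :
    leftMul T x y * a = leftMul T x (((star a : adjointable T) : Z →L[ℂ] Z) y) := by
  ext z
  exact ((adjointable_pair a).mid' x y z).symm

lemma leftMul_conj (a : adjointable T) (x : Z) :
    leftMul T ((a : Z →L[ℂ] Z) x) ((a : Z →L[ℂ] Z) x) = a * leftMul T x x * star a := by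
  rw [mul_leftMul, leftMul_mul, star_star]

lemma leftMul_mul_leftMul (v w x y : Z) :
    leftMul T v w * leftMul T x y = leftMul T (T v w x) y := by
  rw [mul_leftMul, leftMul_apply]

lemma norm_leftMul_le (x y : Z) : ‖leftMul T x y‖ ≤ ‖x‖ * ‖y‖ :=
  opNorm_le_bound _ (by positivity) fun z => IsCStarTernary.norm_le x y z

lemma norm_leftMul_self (x : Z) : ‖leftMul T x x‖ = ‖x‖ ^ 2 := by
  refine le_antisymm ((norm_leftMul_le x x).trans_eq (sq _).symm) ?_
  rcases (norm_nonneg x).eq_or_lt with h0 | h0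
  · rw [← h0]; simp
  · refine le_of_mul_le_mul_right ?_ h0
    calc ‖x‖ ^ 2 * ‖x‖ = ‖T x x x‖ := by rw [IsCStarTernary.norm_cube (T := T)]; ring
      _ ≤ _ := norm_adjointable_apply_le (leftMul T x x) x

lemma leftMul_self_eq_zero {x : Z} (h : leftMul T x x = 0) : x = 0 := by
  have := norm_leftMul_self (T := T) x
  rw [h, norm_zero] at this
  exact norm_eq_zero.mp (pow_eq_zero_iff (by norm_num) |>.mp this.symm)

lemma eq_of_leftMul_left {x y : Z} (h : ∀ z, leftMul T x z = leftMul T y z) : x = y := by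
  refine sub_eq_zero.mp (leftMul_self_eq_zero (T := T) ?_)
  rw [(leftMul T).map_sub₂, h, sub_self]

lemma continuous_leftMul_self : Continuous fun x => leftMul T x x := by
  refine continuous_iff_continuousAt.mpr fun y => tendsto_iff_norm_sub_tendsto_zero.mpr ?_
  have h : Filter.Tendsto (fun x : Z => ‖x - y‖ * (‖x‖ + ‖y‖)) (nhds y) (nhds 0) := by
    have : Continuous fun x : Z => ‖x - y‖ * (‖x‖ + ‖y‖) := by fun_prop
    simpa using this.tendsto y
  refine squeeze_zero (fun _ => norm_nonneg _) (fun x => ?_) h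
  have : leftMul T x x - leftMul T y y = leftMul T (x - y) x + leftMul T y (x - y) := by
    rw [LinearMap.map_sub₂, map_sub]; abel
  calc _ ≤ ‖leftMul T (x - y) x‖ + ‖leftMul T y (x - y)‖ := this ▸ norm_add_le _ _
    _ ≤ ‖x - y‖ * ‖x‖ + ‖y‖ * ‖x - y‖ := add_le_add (norm_leftMul_le _ _) (norm_leftMul_le _ _)
    _ = _ := by ring

lemma isSelfAdjoint_leftMul_self (x : Z) : IsSelfAdjoint (leftMul T x x) := star_leftMul x x

lemma leftMul_smul_smul (c : ℂ) (x : Z) :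
    leftMul T (c • x) (c • x) = (c • 1 : adjointable T) * leftMul T x x * star (c • 1) := by
  rw [LinearMap.map_smul₂, map_smulₛₗ, star_smul, star_one]
  simp [smul_comm c]

/-- Adjointability with respect to the right structure, read on left multiplications. -/
lemma leftMul_right_adjoint (r : adjointable (ternaryFlip T)) (x y : Z) :
    leftMul T x ((r : Z →L[ℂ] Z) y) =
      leftMul T (((star r : adjointable (ternaryFlip T)) : Z →L[ℂ] Z) x) y := by
  ext z
  exact (adjointable_pair r).mid z y x

lemma commute_left_right (a : adjointable T) (r : adjointable (ternaryFlip T)) (x : Z) :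
    (a : Z →L[ℂ] Z) ((r : Z →L[ℂ] Z) x) = (r : Z →L[ℂ] Z) ((a : Z →L[ℂ] Z) x) := by
  refine eq_of_leftMul_left (T := T) fun z => ?_
  have h (u : Z) : leftMul T ((r : Z →L[ℂ] Z) u) z =
      leftMul T u (((star r : adjointable (ternaryFlip T)) : Z →L[ℂ] Z) z) := by
    rw [leftMul_right_adjoint, star_star]
  rw [← mul_leftMul, h, h, ← mul_leftMul]

lemma isUnit_smul_one_sub_leftMul_flip (x : Z) {s : ℂ} (hs : s ≠ 0)
    (h : IsUnit (algebraMap ℂ _ s - leftMul T x x)) :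
    IsUnit (algebraMap ℂ _ s - leftMul (ternaryFlip T) x x) := by
  obtain ⟨e, he1, he2⟩ := isUnit_iff_exists.mp h
  set d := leftMul (ternaryFlip T) x x with hd
  set k := leftMul (ternaryFlip T) ((e : Z →L[ℂ] Z) x) x with hk
  have hs' : (algebraMap ℂ (adjointable T) s) = s • 1 := Algebra.algebraMap_eq_smul_one s
  have hdc : (d : Z →L[ℂ] Z) x = (leftMul T x x : Z →L[ℂ] Z) x := rfl
  have h1 : d * k = s • k - d := by
    have : e * leftMul T x x = s • e - 1 := by
      rw [← he2, hs', mul_sub]; simp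
    rw [hk, mul_leftMul, ← commute_left_right, hdc]
    have h2 : (e : Z →L[ℂ] Z) ((leftMul T x x : Z →L[ℂ] Z) x) = s • (e : Z →L[ℂ] Z) x - x := by
      have := congrArg (fun a : adjointable T => (a : Z →L[ℂ] Z) x) this
      simpa using this
    rw [h2, LinearMap.map_sub₂, LinearMap.map_smul₂]
  have h2 : k * d = s • k - d := by
    have : leftMul T x x * e = s • e - 1 := by
      rw [← he1, hs', sub_mul]; simp
    rw [hk, leftMul_mul, hd, star_leftMul, ← hd, hdc]
    have h3 := leftMul_right_adjoint (T := ternaryFlip T) (leftMul T x x) ((e : Z →L[ℂ] Z) x) x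
    have h2 : (leftMul T x x : Z →L[ℂ] Z) ((e : Z →L[ℂ] Z) x) = s • (e : Z →L[ℂ] Z) x - x := by
      have := congrArg (fun a : adjointable T => (a : Z →L[ℂ] Z) x) this
      simpa using this
    refine h3.trans ?_
    have h4 : ((star (leftMul T x x) : adjointable T) : Z →L[ℂ] Z) ((e : Z →L[ℂ] Z) x) =
        s • (e : Z →L[ℂ] Z) x - x := by rw [star_leftMul, h2]
    refine (congrArg (fun u => leftMul (ternaryFlip T) u x) h4).trans ?_
    rw [LinearMap.map_sub₂, LinearMap.map_smul₂]
  refine isUnit_iff_exists.mpr ⟨s⁻¹ • (1 + k), ?_, ?_⟩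
  · rw [mul_smul_comm, Algebra.algebraMap_eq_smul_one, sub_mul, mul_add d, h1, smul_mul_assoc,
      one_mul, smul_add, mul_one, inv_smul_eq_iff₀ hs]
    abel
  · rw [smul_mul_assoc, Algebra.algebraMap_eq_smul_one, mul_sub, add_mul _ _ d, h2, mul_smul_comm,
      mul_one, smul_add, one_mul, inv_smul_eq_iff₀ hs]
    abel

variable [CompleteSpace Z]

lemma mem_spectrum_leftMul_of_flip {x : Z} {s : ℝ} (hs : s ≠ 0)
    (h : s ∈ spectrum ℝ (leftMul (ternaryFlip T) x x)) : s ∈ spectrum ℝ (leftMul T x x) := by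
  rw [spectrum.mem_iff] at h ⊢
  contrapose! h
  rw [IsScalarTower.algebraMap_apply ℝ ℂ] at h ⊢
  exact isUnit_smul_one_sub_leftMul_flip x (by simpa using hs) h

lemma leftMul_flip_nonneg {x : Z} (h : 0 ≤ leftMul T x x) : 0 ≤ leftMul (ternaryFlip T) x x :=
  nonneg_of_spectrum_subset (isSelfAdjoint_leftMul_self x) (isSelfAdjoint_leftMul_self x)
    (fun _ h0 => mem_spectrum_leftMul_of_flip h0) h

lemma leftMul_flip_nonpos {x : Z} (h : leftMul T x x ≤ 0) : leftMul (ternaryFlip T) x x ≤ 0 :=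
  nonpos_of_spectrum_subset (isSelfAdjoint_leftMul_self x) (isSelfAdjoint_leftMul_self x)
    (fun _ h0 => mem_spectrum_leftMul_of_flip h0) h

lemma leftMul_apply_nonneg {x : Z} (h : 0 ≤ leftMul T x x) (r : adjointable (ternaryFlip T)) :
    0 ≤ leftMul T ((r : Z →L[ℂ] Z) x) ((r : Z →L[ℂ] Z) x) := by
  have h1 := leftMul_flip_nonneg h
  have h2 : 0 ≤ leftMul (ternaryFlip T) ((r : Z →L[ℂ] Z) x) ((r : Z →L[ℂ] Z) x) := by
    rw [leftMul_conj]
    exact star_right_conjugate_nonneg h1 r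
  exact leftMul_flip_nonneg (T := ternaryFlip T) h2

lemma leftMul_eq_zero_of_nonneg_of_nonpos {x y : Z} (hx : 0 ≤ leftMul T x x)
    (hy : leftMul T y y ≤ 0) : leftMul T x y = 0 := by
  have hd := leftMul_flip_nonpos hy
  obtain ⟨r, hr⟩ := CStarAlgebra.nonneg_iff_eq_star_mul_self.mp (neg_nonneg.mpr hd)
  have h1 : leftMul T x y * star (leftMul T x y) =
      leftMul T ((leftMul (ternaryFlip T) y y : Z →L[ℂ] Z) x) x := by
    rw [star_leftMul, leftMul_mul_leftMul]; rfl
  have h2 : leftMul T x y * star (leftMul T x y) =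
      - leftMul T ((r : Z →L[ℂ] Z) x) ((r : Z →L[ℂ] Z) x) := by
    rw [h1, leftMul_right_adjoint, ← LinearMap.map_neg₂]
    congr 1
    have := congrArg (fun a : adjointable (ternaryFlip T) => (a : Z →L[ℂ] Z) x) hr
    rw [neg_eq_iff_eq_neg] at hr
    rw [hr]
    congr 1
  refine CStarRing.mul_star_self_eq_zero_iff _ |>.mp (le_antisymm ?_ (mul_star_self_nonneg _))
  rw [h2, neg_nonpos]
  exact leftMul_apply_nonneg hx r

end LeftOperators

section Cutoff

lemma cfc_mul_mul_star {𝒜 : Type*} [CStarAlgebra 𝒜] {c : 𝒜} (hc : IsSelfAdjoint c) {f : ℝ → ℝ} (hf : Continuous f) :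
    cfc f c * c * star (cfc f c) = cfc (fun s => f s * s * f s) c := by
  have h : star (cfc f c) = cfc f c := (cfc_predicate f c : IsSelfAdjoint _)
  rw [h]
  rw [cfc_mul (fun s => f s * s) f c, cfc_mul f (fun s => s) c, cfc_id' ℝ c hc]

variable {𝒜 : Type*} [CStarAlgebra 𝒜] [PartialOrder 𝒜] [StarOrderedRing 𝒜]

/-- Continuous approximations of the indicator function of the positive half-line. -/
def rampFun (n : ℕ) (s : ℝ) : ℝ := min 1 (max 0 ((n + 1) * s))

lemma continuous_rampFun (n : ℕ) : Continuous (rampFun n) := by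
  unfold rampFun; fun_prop

lemma rampFun_nonneg (n : ℕ) (s : ℝ) : 0 ≤ rampFun n s := by simp [rampFun]

lemma rampFun_le_one (n : ℕ) (s : ℝ) : rampFun n s ≤ 1 := by simp [rampFun]

lemma rampFun_of_nonpos (n : ℕ) {s : ℝ} (hs : s ≤ 0) : rampFun n s = 0 := by
  have : (n + 1 : ℝ) * s ≤ 0 := mul_nonpos_of_nonneg_of_nonpos (by positivity) hs
  simp [rampFun, this]

lemma rampFun_of_le (n N : ℕ) (h : N ≤ n) {s : ℝ} (hs : 1 / (N + 1 : ℝ) ≤ s) :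
    rampFun n s = 1 := by
  have h1 : 1 ≤ (n + 1 : ℝ) * s := by
    calc (1 : ℝ) ≤ (N + 1) * s := by rwa [div_le_iff₀' (by positivity)] at hs
      _ ≤ _ := by
        have : (0 : ℝ) ≤ s := le_trans (by positivity) hs
        gcongr
  simp [rampFun, h1]

lemma sq_mul_le_of_ramp {u s r : ℝ} (hr : 0 ≤ r) (hu : |u| ≤ 1) (h : r ≤ s → u = 0) :
    u * s * u ≤ r := by
  rcases le_total r s with h1 | h1
  · simpa [h h1] using hr
  · have : u ^ 2 ≤ 1 := (sq_le_one_iff_abs_le_one u).mpr hu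
    nlinarith [sq_nonneg u]

lemma exists_cutoff {c : 𝒜} (hc : IsSelfAdjoint c) : ∃ g : ℕ → 𝒜,
    (∀ n, 0 ≤ g n * c * star (g n)) ∧
    (∀ n, (1 - g n) * c * star (1 - g n) ≤ algebraMap ℝ 𝒜 (1 / (n + 1 : ℝ))) ∧
    ∀ N n m, N ≤ n → N ≤ m →
      ‖(g n - g m) * c * star (g n - g m)‖ ≤ 1 / (N + 1 : ℝ) := by
  have hcont := continuous_rampFun
  refine ⟨fun n => cfc (rampFun n) c, fun n => ?_, fun n => ?_, fun N n m hn hm => ?_⟩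
  · rw [cfc_mul_mul_star hc (hcont n)]
    refine cfc_nonneg fun s _ => ?_
    rcases le_total s 0 with h | h
    · simp [rampFun_of_nonpos n h]
    · have := rampFun_nonneg n s
      positivity
  · have h1 : 1 - cfc (rampFun n) c = cfc (fun s => 1 - rampFun n s) c := by
      rw [cfc_sub (fun _ => 1) (rampFun n) c (by fun_prop) (hcont n).continuousOn,
        cfc_const_one ℝ c]
    rw [h1, cfc_mul_mul_star hc (by have := hcont n; fun_prop)]
    refine cfc_le_algebraMap _ _ _ (fun s _ => ?_) (by have := hcont n; fun_prop) hc
    refine sq_mul_le_of_ramp (by positivity) ?_ fun h => ?_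
    · rw [abs_le]; constructor <;> linarith [rampFun_nonneg n s, rampFun_le_one n s]
    · rw [rampFun_of_le n n le_rfl h, sub_self]
  · have hn' := hcont n
    have hm' := hcont m
    rw [← cfc_sub (rampFun n) (rampFun m) c hn'.continuousOn hm'.continuousOn,
      cfc_mul_mul_star hc (by fun_prop)]
    refine norm_cfc_le (by positivity) fun s _ => ?_
    rcases le_total s 0 with h | h
    · simp only [rampFun_of_nonpos _ h, sub_zero, mul_zero, norm_zero]; positivity
    · rw [Real.norm_of_nonneg (by nlinarith [mul_nonneg h (sq_nonneg (rampFun n s - rampFun m s))])]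
      refine sq_mul_le_of_ramp (by positivity) ?_ fun h => ?_
      · rw [abs_le]; constructor <;> linarith [rampFun_nonneg n s, rampFun_le_one n s,
          rampFun_nonneg m s, rampFun_le_one m s]
      · rw [rampFun_of_le n N hn h, rampFun_of_le m N hm h, sub_self]

end Cutoff

section Decomposition

variable {Z : Type*} [NormedAddCommGroup Z] [NormedSpace ℂ Z] [CompleteSpace Z]
  {T : Z →L[ℂ] Z →SL[starRingEnd ℂ] (Z →L[ℂ] Z)} [IsCStarTernary T]

variable (T) in
lemma exists_leftMul_decomposition (x : Z) :
    ∃ p n : Z, p + n = x ∧ 0 ≤ leftMul T p p ∧ leftMul T n n ≤ 0 := by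
  obtain ⟨g, h1, h2, h3⟩ := exists_cutoff (isSelfAdjoint_leftMul_self (T := T) x)
  have hc : CauchySeq fun n => (g n : Z →L[ℂ] Z) x := by
    refine cauchySeq_of_le_tendsto_0 (fun N : ℕ => √(1 / (N + 1 : ℝ))) (fun n m N hn hm => ?_) ?_
    · refine Real.le_sqrt_of_sq_le ?_
      rw [dist_eq_norm, ← norm_leftMul_self (T := T)]
      refine le_of_eq_of_le ?_ (h3 N n m hn hm)
      rw [← leftMul_conj]
      rfl
    · rw [← Real.sqrt_zero]
      exact (Real.continuous_sqrt.tendsto 0).comp tendsto_one_div_add_atTop_nhds_zero_nat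
  obtain ⟨p, hp⟩ := cauchySeq_tendsto_of_complete hc
  refine ⟨p, x - p, by abel, ?_, ?_⟩
  · refine CStarAlgebra.isClosed_nonneg.mem_of_tendsto
      (((continuous_leftMul_self (T := T)).tendsto p).comp hp) (Filter.Eventually.of_forall ?_)
    intro n
    simp only [Function.comp, Set.mem_ofPred_eq]
    rw [leftMul_conj]
    exact h1 n
  · have e1 : Filter.Tendsto (fun n : ℕ => algebraMap ℝ (adjointable T) (1 / (n + 1 : ℝ)) -
        leftMul T (x - (g n : Z →L[ℂ] Z) x) (x - (g n : Z →L[ℂ] Z) x)) Filter.atTop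
        (nhds (0 - leftMul T (x - p) (x - p))) := by
      refine Filter.Tendsto.sub ?_
        (((continuous_leftMul_self (T := T)).tendsto _).comp (tendsto_const_nhds.sub hp))
      rw [← map_zero (algebraMap ℝ (adjointable T))]
      exact ((continuous_algebraMap ℝ _).tendsto 0).comp tendsto_one_div_add_atTop_nhds_zero_nat
    rw [← neg_nonneg, ← zero_sub]
    refine CStarAlgebra.isClosed_nonneg.mem_of_tendsto e1 (Filter.Eventually.of_forall ?_)
    intro n
    have := h2 n
    rw [← leftMul_conj] at this
    exact sub_nonneg.mpr this

variable {x y p n p' n' : Z}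

lemma leftMul_eq_zero_of_nonpos_of_nonneg (hx : leftMul T x x ≤ 0) (hy : 0 ≤ leftMul T y y) :
    leftMul T x y = 0 := by
  rw [← star_leftMul, leftMul_eq_zero_of_nonneg_of_nonpos hy hx, star_zero]

lemma leftMul_add_nonneg (hx : 0 ≤ leftMul T x x) (hy : 0 ≤ leftMul T y y) :
    0 ≤ leftMul T (x + y) (x + y) := by
  obtain ⟨p, n, h, hp, hn⟩ := exists_leftMul_decomposition T (x + y)
  have h1 : leftMul T (x + y) n = 0 := by
    rw [LinearMap.map_add₂, leftMul_eq_zero_of_nonneg_of_nonpos hx hn,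
      leftMul_eq_zero_of_nonneg_of_nonpos hy hn, add_zero]
  rw [← h, LinearMap.map_add₂, leftMul_eq_zero_of_nonneg_of_nonpos hp hn, zero_add] at h1
  rw [← h, leftMul_self_eq_zero h1, add_zero]
  exact hp

lemma leftMul_add_nonpos (hx : leftMul T x x ≤ 0) (hy : leftMul T y y ≤ 0) :
    leftMul T (x + y) (x + y) ≤ 0 := by
  obtain ⟨p, n, h, hp, hn⟩ := exists_leftMul_decomposition T (x + y)
  have h1 : leftMul T (x + y) p = 0 := by
    rw [LinearMap.map_add₂, leftMul_eq_zero_of_nonpos_of_nonneg hx hp,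
      leftMul_eq_zero_of_nonpos_of_nonneg hy hp, add_zero]
  rw [← h, LinearMap.map_add₂, leftMul_eq_zero_of_nonpos_of_nonneg hn hp, add_zero] at h1
  rw [← h, leftMul_self_eq_zero h1, zero_add]
  exact hn

lemma leftMul_smul_nonneg (c : ℂ) (hx : 0 ≤ leftMul T x x) :
    0 ≤ leftMul T (c • x) (c • x) := by
  rw [leftMul_smul_smul]
  exact star_right_conjugate_nonneg hx _

lemma leftMul_smul_nonpos (c : ℂ) (hx : leftMul T x x ≤ 0) :
    leftMul T (c • x) (c • x) ≤ 0 := by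
  rw [leftMul_smul_smul, ← neg_nonneg, ← neg_mul, ← mul_neg]
  exact star_right_conjugate_nonneg (neg_nonneg.mpr hx) _

lemma leftMul_decomposition_unique (h : p + n = p' + n') (hp : 0 ≤ leftMul T p p)
    (hn : leftMul T n n ≤ 0) (hp' : 0 ≤ leftMul T p' p') (hn' : leftMul T n' n' ≤ 0) :
    p = p' := by
  have h1 : p - p' = n' - n := by rw [sub_eq_sub_iff_add_eq_add, h]; abel
  have h2 : leftMul T (p - p') (p - p') = 0 := by
    conv_lhs => enter [2]; rw [h1]
    rw [LinearMap.map_sub₂, map_sub, map_sub, leftMul_eq_zero_of_nonneg_of_nonpos hp hn,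
      leftMul_eq_zero_of_nonneg_of_nonpos hp hn', leftMul_eq_zero_of_nonneg_of_nonpos hp' hn,
      leftMul_eq_zero_of_nonneg_of_nonpos hp' hn']
    simp
  exact sub_eq_zero.mp (leftMul_self_eq_zero h2)

variable (T) in
/-- The symmetry of a C*-ternary ring whose `1`-eigenspace is positive and whose
`-1`-eigenspace is negative. -/
lemma exists_ternarySymmetry_linear : ∃ J : Z →ₗ[ℂ] Z, ∀ x, ∃ p n : Z,
    x = p + n ∧ J x = p - n ∧ 0 ≤ leftMul T p p ∧ leftMul T n n ≤ 0 := by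
  choose p n h hp hn using exists_leftMul_decomposition T
  have hadd (x y : Z) : p (x + y) = p x + p y :=
    leftMul_decomposition_unique (n := n (x + y)) (n' := n x + n y)
      (by rw [h, add_add_add_comm, h, h]) (hp _) (hn _)
      (leftMul_add_nonneg (hp _) (hp _)) (leftMul_add_nonpos (hn _) (hn _))
  have hsmul (c : ℂ) (x : Z) : p (c • x) = c • p x :=
    leftMul_decomposition_unique (n := n (c • x)) (n' := c • n x)
      (by rw [h, ← smul_add, h]) (hp _) (hn _)
      (leftMul_smul_nonneg c (hp _)) (leftMul_smul_nonpos c (hn _))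
  refine ⟨(2 : ℂ) • { toFun := p, map_add' := hadd, map_smul' := hsmul } - LinearMap.id,
    fun x => ⟨p x, n x, (h x).symm, ?_, hp x, hn x⟩⟩
  rw [eq_sub_iff_add_eq]
  simp only [LinearMap.sub_apply, LinearMap.smul_apply, LinearMap.coe_mk, AddHom.coe_mk,
    LinearMap.id_apply]
  nth_rewrite 2 [← h x]
  rw [two_smul]
  abel

variable (T) in
lemma exists_ternarySymmetry : ∃ J : Z →L[ℂ] Z, (∀ x, J (J x) = x) ∧ (∀ x, ‖J x‖ = ‖x‖) ∧
    (∀ x y z, T (J x) y z = T x (J y) z) ∧ (∀ x y z, T x (J y) z = T x y (J z)) ∧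
    (∀ x y z, T x y (J z) = J (T x y z)) ∧ ∀ x, 0 ≤ leftMul T (J x) x := by
  obtain ⟨J, hJ⟩ := exists_ternarySymmetry_linear T
  have swap (x y : Z) : leftMul T (J x) y = leftMul T x (J y) := by
    obtain ⟨p, n, hx, hJx, hp, hn⟩ := hJ x
    obtain ⟨p', n', hy, hJy, hp', hn'⟩ := hJ y
    rw [hJx, hJy, hx, hy, LinearMap.map_sub₂, LinearMap.map_add₂, map_add, map_add, map_sub,
      map_sub, leftMul_eq_zero_of_nonneg_of_nonpos hp hn',
      leftMul_eq_zero_of_nonpos_of_nonneg hn hp']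
    abel
  have swap' (x y : Z) : leftMul (ternaryFlip T) (J x) y = leftMul (ternaryFlip T) x (J y) := by
    obtain ⟨p, n, hx, hJx, hp, hn⟩ := hJ x
    obtain ⟨p', n', hy, hJy, hp', hn'⟩ := hJ y
    rw [hJx, hJy, hx, hy, LinearMap.map_sub₂, LinearMap.map_add₂, map_add, map_add, map_sub,
      map_sub, leftMul_eq_zero_of_nonneg_of_nonpos (leftMul_flip_nonneg hp)
        (leftMul_flip_nonpos hn'),
      leftMul_eq_zero_of_nonpos_of_nonneg (leftMul_flip_nonpos hn) (leftMul_flip_nonneg hp')]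
    abel
  have hpos (x : Z) : 0 ≤ leftMul T (J x) x := by
    obtain ⟨p, n, hx, hJx, hp, hn⟩ := hJ x
    rw [hJx, hx, LinearMap.map_sub₂, map_add, map_add,
      leftMul_eq_zero_of_nonneg_of_nonpos hp hn, leftMul_eq_zero_of_nonpos_of_nonneg hn hp,
      add_zero, zero_add]
    exact sub_nonneg.mpr (hn.trans hp)
  have hself (x : Z) : leftMul T (J x) (J x) = leftMul T x x := by
    obtain ⟨p, n, hx, hJx, hp, hn⟩ := hJ x
    rw [hJx, hx, LinearMap.map_sub₂, LinearMap.map_add₂, map_add, map_add, map_sub, map_sub,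
      leftMul_eq_zero_of_nonneg_of_nonpos hp hn, leftMul_eq_zero_of_nonpos_of_nonneg hn hp]
    abel
  have hnorm (x : Z) : ‖J x‖ = ‖x‖ := by
    rw [← sq_eq_sq₀ (norm_nonneg _) (norm_nonneg _), ← norm_leftMul_self (T := T), hself,
      norm_leftMul_self]
  have hJJ (x : Z) : J (J x) = x := by
    obtain ⟨p, n, hx, hJx, hp, hn⟩ := hJ x
    obtain ⟨p', n', hx', hJx', hp', hn'⟩ := hJ (J x)
    have hn0 : leftMul T (-n) (-n) ≤ 0 := by simpa using hn
    have : p = p' := leftMul_decomposition_unique (by rw [← hx', hJx, sub_eq_add_neg]) hp hn0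
      hp' hn'
    rw [hJx', ← this, hx]
    rw [hJx, ← this] at hx'
    have : n' = - n := by
      rw [sub_eq_add_neg] at hx'
      exact (add_left_cancel hx').symm
    rw [this, sub_neg_eq_add]
  refine ⟨J.mkContinuous 1 fun x => by rw [hnorm, one_mul], hJJ, hnorm,
    fun x y z => congrArg (fun a : adjointable T => (a : Z →L[ℂ] Z) z) (swap x y),
    fun x y z => congrArg (fun a : adjointable (ternaryFlip T) => (a : Z →L[ℂ] Z) x)
      (swap' z y).symm, fun x y z => ?_, hpos⟩
  refine eq_of_leftMul_left (T := T) fun w => ?_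
  change leftMul T ((leftMul T x y : Z →L[ℂ] Z) (J z)) w =
    leftMul T (J ((leftMul T x y : Z →L[ℂ] Z) z)) w
  rw [swap, ← mul_leftMul, ← mul_leftMul, swap]

end Decomposition

section States

variable {𝒜 : Type*} [CStarAlgebra 𝒜] [PartialOrder 𝒜] [StarOrderedRing 𝒜]
  {Z : Type*} [NormedAddCommGroup Z] [NormedSpace ℂ Z]

/-- A positive functional of norm at most one on a C*-algebra. -/
structure IsSubstate (φ : 𝒜 →ₗ[ℂ] ℂ) : Prop where
  map_star : ∀ a, φ (star a) = (starRingEnd ℂ) (φ a)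
  re_nonneg : ∀ a, 0 ≤ a → 0 ≤ (φ a).re
  re_one_le : (φ 1).re ≤ 1

lemma IsSubstate.re_le_norm {φ : 𝒜 →ₗ[ℂ] ℂ} (hφ : IsSubstate φ) {a : 𝒜} (ha : 0 ≤ a) :
    (φ a).re ≤ ‖a‖ := by
  have h1 := hφ.re_nonneg _ (sub_nonneg.mpr (IsSelfAdjoint.of_nonneg ha).le_algebraMap_norm_self)
  have h2 := mul_le_of_le_one_right (norm_nonneg a) hφ.re_one_le
  have h3 : φ (algebraMap ℝ 𝒜 ‖a‖) = (‖a‖ : ℂ) * φ 1 := by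
    rw [IsScalarTower.algebraMap_apply ℝ ℂ, Algebra.algebraMap_eq_smul_one, map_smul]
    simp
  rw [map_sub, h3, Complex.sub_re, Complex.re_ofReal_mul] at h1
  linarith

lemma sesquilinear_smul_smul {ℬ : Type*} [AddCommGroup ℬ] [Module ℂ ℬ]
    (L : Z →ₗ[ℂ] Z →ₗ⋆[ℂ] ℬ) (c d : ℂ) (x y : Z) :
    L (c • x) (d • y) = (c * (starRingEnd ℂ) d) • L x y := by
  rw [LinearMap.map_smul₂, map_smulₛₗ, smul_smul]

lemma sesquilinear_smul_self {ℬ : Type*} [AddCommGroup ℬ] [Module ℂ ℬ]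
    (L : Z →ₗ[ℂ] Z →ₗ⋆[ℂ] ℬ) (c : ℂ) (x : Z) :
    L (c • x) (c • x) = (‖c‖ ^ 2 : ℝ) • L x x := by
  rw [sesquilinear_smul_smul, RCLike.mul_conj, ← Complex.coe_smul]
  simp

/-- A positive sesquilinear form with values in a C*-algebra which induces the norm. -/
structure IsNormingForm (L : Z →ₗ[ℂ] Z →ₗ⋆[ℂ] 𝒜) : Prop where
  star_eq : ∀ x y, star (L x y) = L y x
  nonneg : ∀ x, 0 ≤ L x x
  norm_le : ∀ x y, ‖L x y‖ ≤ ‖x‖ * ‖y‖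
  norm_sq_le : ∀ x, ‖x‖ ^ 2 ≤ ‖L x x‖

variable {L : Z →ₗ[ℂ] Z →ₗ⋆[ℂ] 𝒜}

namespace IsNormingForm

lemma cross_le (hL : IsNormingForm L) (c d : ℂ) (x y : Z) :
    L (c • x) (d • y) + L (d • y) (c • x) ≤
      (‖c‖ ^ 2 : ℝ) • L y y + (‖d‖ ^ 2 : ℝ) • L x x := by
  have h := hL.nonneg ((starRingEnd ℂ) d • x - (starRingEnd ℂ) c • y)
  have h2 : L ((starRingEnd ℂ) d • x - (starRingEnd ℂ) c • y)
      ((starRingEnd ℂ) d • x - (starRingEnd ℂ) c • y) =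
      (‖c‖ ^ 2 : ℝ) • L y y + (‖d‖ ^ 2 : ℝ) • L x x
        - (L (c • x) (d • y) + L (d • y) (c • x)) := by
    rw [LinearMap.map_sub₂, map_sub, map_sub, sesquilinear_smul_self, sesquilinear_smul_self,
      RCLike.norm_conj, RCLike.norm_conj]
    simp only [sesquilinear_smul_smul, Complex.conj_conj, mul_comm]
    abel
  rw [h2] at h
  exact sub_nonneg.mp h

variable (f' : Z →L[ℂ] ℂ)

lemma cross_sum_le (hL : IsNormingForm L) (y : Z) (c : ℂ) (l : List Z) :
    L (c • y) (l.map fun x => (starRingEnd ℂ) (f' x) • x).sum +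
      L (l.map fun x => (starRingEnd ℂ) (f' x) • x).sum (c • y) ≤
      (‖c‖ ^ 2 : ℝ) • (l.map fun x => L x x).sum +
        (l.map fun x => ‖f' x‖ ^ 2).sum • L y y := by
  induction l with
  | nil => simp
  | cons x l ih =>
    simp only [List.map_cons, List.sum_cons, map_add, LinearMap.add_apply, smul_add, add_smul]
    have h := hL.cross_le c ((starRingEnd ℂ) (f' x)) y x
    rw [RCLike.norm_conj] at h
    refine (le_of_eq ?_).trans ((add_le_add h ih).trans (le_of_eq ?_)) <;> abel

lemma sum_le (hL : IsNormingForm L) (l : List Z) :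
    L (l.map fun x => (starRingEnd ℂ) (f' x) • x).sum
      (l.map fun x => (starRingEnd ℂ) (f' x) • x).sum ≤
      (l.map fun x => ‖f' x‖ ^ 2).sum • (l.map fun x => L x x).sum := by
  induction l with
  | nil => simp
  | cons x l ih =>
    simp only [List.map_cons, List.sum_cons, map_add, LinearMap.add_apply, smul_add, add_smul]
    have h := hL.cross_sum_le f' x ((starRingEnd ℂ) (f' x)) l
    have h2 := sesquilinear_smul_self L ((starRingEnd ℂ) (f' x)) x
    rw [RCLike.norm_conj] at h h2
    rw [h2]
    refine (le_of_eq ?_).trans ((add_le_add (le_refl ((‖f' x‖ ^ 2 : ℝ) • L x x))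
      (add_le_add h ih)).trans (le_of_eq ?_)) <;> abel

lemma sum_nonneg (hL : IsNormingForm L) (l : List Z) : 0 ≤ (l.map fun x => L x x).sum :=
  List.sum_nonneg fun a ha => by
    obtain ⟨x, _, rfl⟩ := List.mem_map.mp ha
    exact hL.nonneg x

lemma sum_sq_le_norm (hL : IsNormingForm L) (hf : ‖f'‖ ≤ 1) (l : List Z) :
    (l.map fun x => ‖f' x‖ ^ 2).sum ≤ ‖(l.map fun x => L x x).sum‖ := by
  set S := (l.map fun x => ‖f' x‖ ^ 2).sum with hS
  set z := (l.map fun x => (starRingEnd ℂ) (f' x) • x).sum with hz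
  have hS0 : 0 ≤ S := List.sum_nonneg fun a ha => by
    obtain ⟨x, _, rfl⟩ := List.mem_map.mp ha
    positivity
  have h1 : f' z = (S : ℂ) := by
    rw [hz, hS]
    clear * -
    induction l with
    | nil => simp
    | cons x l ih =>
      simp only [List.map_cons, List.sum_cons, map_add, ih, Complex.ofReal_add]
      rw [map_smul, smul_eq_mul, RCLike.conj_mul]
      simp
  have h2 : S ≤ ‖z‖ := by
    have := f'.le_of_opNorm_le hf z
    rwa [h1, Complex.norm_real, Real.norm_of_nonneg hS0, one_mul] at this
  have h3 : S ^ 2 ≤ S * ‖(l.map fun x => L x x).sum‖ := by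
    calc S ^ 2 ≤ ‖z‖ ^ 2 := by gcongr
      _ ≤ ‖L z z‖ := hL.norm_sq_le z
      _ ≤ ‖S • (l.map fun x => L x x).sum‖ :=
        CStarAlgebra.norm_le_norm_of_nonneg_of_le (hL.nonneg z) (hL.sum_le f' l)
      _ = _ := by rw [norm_smul, Real.norm_of_nonneg hS0]
  rcases hS0.eq_or_lt with h | h
  · rw [← h]; positivity
  · exact le_of_mul_le_mul_left (by rwa [sq] at h3) h

lemma exists_separating [Nontrivial 𝒜] (hL : IsNormingForm L) (hf : ‖f'‖ ≤ 1) :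
    ∃ ω : 𝒜 →L[ℂ] ℂ, 0 < (ω 1).re ∧ (∀ a, 0 ≤ a → 0 ≤ (ω a).re) ∧
      ∀ x, ‖f' x‖ ^ 2 * (ω 1).re ≤ (ω (L x x)).re := by
  let q : List Z → 𝒜 := fun l => (l.map fun x => L x x).sum
  let S : List Z → ℝ := fun l => (l.map fun x => ‖f' x‖ ^ 2).sum
  let K : Set 𝒜 := {k | ∃ l, q l - S l • (1 : 𝒜) ≤ k}
  have hadd : ∀ a ∈ K, ∀ b ∈ K, a + b ∈ K := by
    rintro a ⟨l, hl⟩ b ⟨m, hm⟩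
    refine ⟨l ++ m, (le_of_eq ?_).trans (add_le_add hl hm)⟩
    simp only [q, S, List.map_append, List.sum_append, add_smul]
    abel
  have hsmul : ∀ r : ℝ, 0 ≤ r → ∀ a ∈ K, r • a ∈ K := by
    rintro r hr a ⟨l, hl⟩
    refine ⟨l.map fun x => ((√r : ℝ) : ℂ) • x,
      (le_of_eq ?_).trans (smul_le_smul_of_nonneg_left hl hr)⟩
    have h1 : ‖((√r : ℝ) : ℂ)‖ ^ 2 = r := by
      rw [Complex.norm_real, Real.norm_of_nonneg (Real.sqrt_nonneg r), Real.sq_sqrt hr]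
    have h2 : q (l.map fun x => ((√r : ℝ) : ℂ) • x) = r • q l := by
      simp only [q, List.map_map, Function.comp_def, sesquilinear_smul_self, h1, List.smul_sum]
    have h3 : S (l.map fun x => ((√r : ℝ) : ℂ) • x) = r * S l := by
      simp only [S, List.map_map, Function.comp_def, map_smul, smul_eq_mul, norm_mul, mul_pow, h1,
        List.sum_map_mul_left]
    rw [h2, h3, smul_sub, mul_smul]
  have hconv : Convex ℝ K := fun a ha b hb s t hs ht _ =>
    hadd _ (hsmul s hs a ha) _ (hsmul t ht b hb)
  have h0K : (0 : 𝒜) ∈ K := ⟨[], by simp [q, S]⟩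
  have hdisj : Disjoint (Metric.ball (-1 : 𝒜) 1) K := by
    rw [Set.disjoint_left]
    rintro k hk ⟨l, hl⟩
    rw [mem_ball_iff_norm, sub_neg_eq_add] at hk
    have hq := hL.sum_nonneg l
    have hS := hL.sum_sq_le_norm f' hf l
    have hks : IsSelfAdjoint k := by
      have h1 : IsSelfAdjoint (q l - S l • (1 : 𝒜)) :=
        (IsSelfAdjoint.of_nonneg hq).sub ((IsSelfAdjoint.all (S l)).smul (IsSelfAdjoint.one 𝒜))
      have h2 := (IsSelfAdjoint.of_nonneg (sub_nonneg.mpr hl)).add h1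
      rwa [sub_add_cancel] at h2
    have h2 : q l ≤ algebraMap ℝ 𝒜 (S l - (1 - ‖k + 1‖)) := by
      have h3 := (hks.add (IsSelfAdjoint.one 𝒜)).le_algebraMap_norm_self
      have h4 := add_le_add hl h3
      rw [map_sub, map_sub, map_one, Algebra.algebraMap_eq_smul_one (S l)]
      rw [← sub_nonneg] at h4 ⊢
      convert h4 using 1
      abel
    have h3 : 0 ≤ S l - (1 - ‖k + 1‖) := by
      by_contra! h
      have h4 : algebraMap ℝ 𝒜 (S l - (1 - ‖k + 1‖)) = 0 := by
        refine le_antisymm ?_ (hq.trans h2)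
        rw [← map_zero (algebraMap ℝ 𝒜)]
        exact algebraMap_mono 𝒜 h.le
      rw [map_eq_zero] at h4
      exact h.ne h4
    have h4 := (CStarAlgebra.norm_le_iff_le_algebraMap (q l) h3 hq).mpr h2
    have h5 : S l ≤ ‖q l‖ := hS
    linarith
  obtain ⟨ω, u, h1, h2⟩ := RCLike.geometric_hahn_banach_open (𝕜 := ℂ) (convex_ball (-1 : 𝒜) 1)
    Metric.isOpen_ball hconv hdisj
  have hu : u ≤ 0 := by simpa using h2 0 h0K
  have hK : ∀ k ∈ K, 0 ≤ (ω k).re := by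
    intro k hk
    by_contra! h
    have h3 := h2 _ (hsmul ((u - 1) / (ω k).re) (div_nonneg_of_nonpos (by linarith) h.le) k hk)
    rw [← Complex.coe_smul, map_smul, smul_eq_mul, RCLike.re_eq_complex_re,
      Complex.re_ofReal_mul, div_mul_cancel₀ _ h.ne] at h3
    linarith
  refine ⟨ω, ?_, fun a ha => hK a ⟨[], by simpa [q, S] using ha⟩, fun x => ?_⟩
  · have := h1 (-1) (Metric.mem_ball_self one_pos)
    rw [map_neg, RCLike.re_eq_complex_re, Complex.neg_re] at this
    linarith
  · have := hK (L x x - (‖f' x‖ ^ 2 : ℝ) • (1 : 𝒜)) ⟨[x], by simp [q, S]⟩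
    rw [← Complex.coe_smul, map_sub, map_smul, smul_eq_mul, Complex.sub_re,
      Complex.re_ofReal_mul] at this
    linarith

/-- A functional in the unit ball is dominated by a positive functional composed with a norming
form. -/
lemma exists_substate (hL : IsNormingForm L) (hf : ‖f'‖ ≤ 1) :
    ∃ φ : 𝒜 →ₗ[ℂ] ℂ, IsSubstate φ ∧ ∀ x, ‖f' x‖ ^ 2 ≤ (φ (L x x)).re := by
  rcases subsingleton_or_nontrivial 𝒜 with h | h
  · refine ⟨0, ⟨by simp, by simp, by simp⟩, fun x => ?_⟩
    have h1 := hL.norm_sq_le x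
    rw [Subsingleton.elim (L x x) 0, norm_zero] at h1
    have : x = 0 := by
      rw [← norm_eq_zero]
      exact pow_eq_zero_iff two_ne_zero |>.mp (le_antisymm h1 (by positivity))
    simp [this]
  · obtain ⟨ω, h1, h2, h3⟩ := hL.exists_separating f' hf
    let φ : 𝒜 →ₗ[ℂ] ℂ :=
      { toFun := fun a => ((2 * (ω 1).re : ℝ) : ℂ)⁻¹ * (ω a + (starRingEnd ℂ) (ω (star a)))
        map_add' := fun a b => by simp only [star_add, map_add]; ring
        map_smul' := fun c a => by
          simp only [star_smul, map_smul, smul_eq_mul, map_mul, RCLike.star_def,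
            Complex.conj_conj, RingHom.id_apply]
          ring }
    have hφ (a : 𝒜) (ha : IsSelfAdjoint a) : (φ a).re = (ω a).re / (ω 1).re := by
      change (((2 * (ω 1).re : ℝ) : ℂ)⁻¹ * (ω a + (starRingEnd ℂ) (ω (star a)))).re = _
      rw [ha.star_eq, ← Complex.ofReal_inv, Complex.re_ofReal_mul, Complex.add_re, Complex.conj_re]
      field_simp
      ring
    refine ⟨φ, ⟨fun a => ?_, fun a ha => ?_, ?_⟩, fun x => ?_⟩
    · change _ * _ = (starRingEnd ℂ) (_ * _)
      rw [star_star, map_mul, map_inv₀, Complex.conj_ofReal, map_add, Complex.conj_conj, add_comm]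
    · rw [hφ a (IsSelfAdjoint.of_nonneg ha)]
      exact div_nonneg (h2 a ha) h1.le
    · rw [hφ 1 (IsSelfAdjoint.one 𝒜), div_self h1.ne']
    · rw [hφ _ (IsSelfAdjoint.of_nonneg (hL.nonneg x)), le_div_iff₀ h1]
      exact h3 x

end IsNormingForm

end States

section PositiveForms

variable {Z : Type*} [NormedAddCommGroup Z] [NormedSpace ℂ Z]

/-- A bounded positive semidefinite sesquilinear form. -/
structure IsPositiveForm (s : Z →ₗ[ℂ] Z →ₗ⋆[ℂ] ℂ) : Prop where
  conj_symm : ∀ x y, (starRingEnd ℂ) (s x y) = s y x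
  re_nonneg : ∀ x, 0 ≤ (s x x).re
  bounded : ∃ M : ℝ, ∀ x, √(s x x).re ≤ M * ‖x‖

namespace IsPositiveForm

variable {s : Z →ₗ[ℂ] Z →ₗ⋆[ℂ] ℂ}

/-- A copy of the underlying space, with the seminorm of a positive form. -/
def PreHilbert (_ : IsPositiveForm s) : Type _ := Z

instance (hs : IsPositiveForm s) : AddCommGroup hs.PreHilbert := inferInstanceAs (AddCommGroup Z)

instance (hs : IsPositiveForm s) : Module ℂ hs.PreHilbert := inferInstanceAs (Module ℂ Z)

/-- The semi-inner product attached to a positive form. -/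
abbrev innerCore (hs : IsPositiveForm s) : PreInnerProductSpace.Core ℂ hs.PreHilbert where
  inner x y := s y x
  conj_inner_symm x y := hs.conj_symm x y
  re_inner_nonneg x := hs.re_nonneg x
  add_left x y z := map_add (s z) x y
  smul_left x y r := map_smulₛₗ (s y) r x

instance (hs : IsPositiveForm s) : SeminormedAddCommGroup hs.PreHilbert :=
  InnerProductSpace.Core.toSeminormedAddCommGroup (c := hs.innerCore)

instance (hs : IsPositiveForm s) : InnerProductSpace ℂ hs.PreHilbert :=
  InnerProductSpace.ofCore hs.innerCore

/-- The canonical map into the Hilbert space completion. -/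
def embed (hs : IsPositiveForm s) : Z →L[ℂ] UniformSpace.Completion hs.PreHilbert :=
  LinearMap.mkContinuous
    { toFun := fun x => ((show hs.PreHilbert from x) : UniformSpace.Completion hs.PreHilbert)
      map_add' := fun x y =>
        UniformSpace.Completion.coe_add (α := hs.PreHilbert) x y
      map_smul' := fun c x =>
        UniformSpace.Completion.coe_smul (X := hs.PreHilbert) c x }
    hs.bounded.choose
    fun x => (UniformSpace.Completion.norm_coe (E := hs.PreHilbert) x).trans_le
      (hs.bounded.choose_spec x)

lemma inner_embed (hs : IsPositiveForm s) (x y : Z) :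
    inner ℂ (hs.embed x) (hs.embed y) = s y x :=
  UniformSpace.Completion.inner_coe (𝕜 := ℂ) (E := hs.PreHilbert) x y

lemma norm_embed (hs : IsPositiveForm s) (x : Z) : ‖hs.embed x‖ = √(s x x).re :=
  UniformSpace.Completion.norm_coe (E := hs.PreHilbert) x

lemma denseRange_embed (hs : IsPositiveForm s) : DenseRange hs.embed :=
  UniformSpace.Completion.denseRange_coe (α := hs.PreHilbert)

lemma norm_le_sqrt (hs : IsPositiveForm s) (x y : Z) :
    ‖s x y‖ ≤ √(s x x).re * √(s y y).re := by
  rw [← hs.inner_embed, ← hs.norm_embed, ← hs.norm_embed, mul_comm]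
  exact norm_inner_le_norm _ _

end IsPositiveForm

/-- Through a map into a Hilbert space, an element of the bidual is represented by a vector
in the closure of the image of a ball. -/
lemma exists_bidual_representation {E : Type*} [NormedAddCommGroup E] [InnerProductSpace ℂ E]
    [CompleteSpace E] (ι : Z →L[ℂ] E) (F : (Z →L[ℂ] ℂ) →L[ℂ] ℂ) :
    ∃ h ∈ closure (ι '' Metric.closedBall 0 ‖F‖), ∀ g : E →L[ℂ] ℂ, F (g.comp ι) = g h := by
  let θ : E →L[ℂ] ℂ := LinearMap.mkContinuous
    { toFun := fun k => (starRingEnd ℂ) (F ((InnerProductSpace.toDual ℂ E k).comp ι))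
      map_add' := fun x y => by
        rw [map_add, ContinuousLinearMap.add_comp, map_add, map_add]
      map_smul' := fun c x => by
        rw [map_smulₛₗ, ContinuousLinearMap.smul_comp, map_smul]
        simp }
    (‖F‖ * ‖ι‖) fun x => by
      simp only [LinearMap.coe_mk, AddHom.coe_mk, RCLike.norm_conj]
      refine (F.le_opNorm _).trans ?_
      rw [mul_assoc, mul_comm ‖ι‖]
      gcongr
      refine (ContinuousLinearMap.opNorm_comp_le _ _).trans ?_
      rw [LinearIsometryEquiv.norm_map]
  obtain ⟨h, hh⟩ := (InnerProductSpace.toDual ℂ E).surjective θ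
  have hrep (g : E →L[ℂ] ℂ) : F (g.comp ι) = g h := by
    obtain ⟨k, rfl⟩ := (InnerProductSpace.toDual ℂ E).surjective g
    have h1 : (starRingEnd ℂ) (F ((InnerProductSpace.toDual ℂ E k).comp ι)) = inner ℂ h k := by
      rw [← InnerProductSpace.toDual_apply_apply, hh]
      rfl
    rw [InnerProductSpace.toDual_apply_apply, ← inner_conj_symm, ← h1, Complex.conj_conj]
  refine ⟨h, ?_, hrep⟩
  by_contra hcon
  have hconv : Convex ℝ (closure (ι '' Metric.closedBall 0 ‖F‖)) :=
    ((convex_closedBall (0 : Z) ‖F‖).is_linear_image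
      (IsLinearMap.mk (fun x y => map_add ι x y) fun c x => by
        rw [← Complex.coe_smul, map_smul, Complex.coe_smul])).closure
  obtain ⟨g, u, h1, h2⟩ := RCLike.geometric_hahn_banach_closed_point (𝕜 := ℂ) hconv
    isClosed_closure hcon
  have h3 : ∀ x : Z, ‖x‖ ≤ ‖F‖ → ‖g (ι x)‖ ≤ u := by
    intro x hx
    obtain ⟨c, hc, hc2⟩ : ∃ c : ℂ, ‖c‖ ≤ 1 ∧ c * g (ι x) = ‖g (ι x)‖ := by
      rcases eq_or_ne (g (ι x)) 0 with h | h
      · exact ⟨0, by simp, by simp [h]⟩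
      · refine ⟨‖g (ι x)‖ / g (ι x), ?_, div_mul_cancel₀ _ h⟩
        rw [norm_div, Complex.norm_real, norm_norm, div_self (norm_ne_zero_iff.mpr h)]
    have h4 := h1 (ι (c • x)) (subset_closure ⟨c • x, by
      rw [mem_closedBall_zero_iff, norm_smul]
      exact (mul_le_of_le_one_left (norm_nonneg _) hc).trans hx, rfl⟩)
    rw [map_smul, map_smul, smul_eq_mul, hc2] at h4
    exact (by simpa using h4 : ‖g (ι x)‖ < u).le
  have h0 : 0 ≤ u := by simpa using h3 0 (by simp)
  have h4 : ‖F‖ * ‖g.comp ι‖ ≤ u := by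
    rcases (norm_nonneg F).eq_or_lt with h | h
    · rw [← h, zero_mul]; exact h0
    · rw [← le_div_iff₀' h]
      refine ContinuousLinearMap.opNorm_le_bound _ (by positivity) fun x => ?_
      rcases eq_or_ne x 0 with rfl | hx
      · simp
      · have hx' : 0 < ‖x‖ := norm_pos_iff.mpr hx
        have h5 := h3 (((‖F‖ / ‖x‖ : ℝ) : ℂ) • x) (by
          rw [norm_smul, Complex.norm_real, Real.norm_of_nonneg (by positivity),
            div_mul_cancel₀ _ hx'.ne'])
        rw [map_smul, map_smul, norm_smul, Complex.norm_real,
          Real.norm_of_nonneg (by positivity)] at h5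
        rw [ContinuousLinearMap.comp_apply]
        rw [div_mul_eq_mul_div, div_le_iff₀ hx'] at h5
        rw [div_mul_eq_mul_div, le_div_iff₀ h]
        linarith
  have h5 : (g h).re ≤ ‖F‖ * ‖g.comp ι‖ := by
    rw [← hrep]
    exact (Complex.re_le_norm _).trans (F.le_opNorm _)
  have h6 : u < (g h).re := h2
  linarith

namespace IsPositiveForm

variable {s : Z →ₗ[ℂ] Z →ₗ⋆[ℂ] ℂ}

lemma exists_extension (hs : IsPositiveForm s) (ψ : Z →L[ℂ] ℂ) {r : ℝ} (hr : 0 ≤ r)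
    (hψ : ∀ x, ‖ψ x‖ ≤ r * √(s x x).re) :
    ∃ g : UniformSpace.Completion hs.PreHilbert →L[ℂ] ℂ, ‖g‖ ≤ r ∧ g.comp hs.embed = ψ := by
  have h : ∀ x, ‖(ψ : Z →ₗ[ℂ] ℂ) x‖ ≤ r * ‖(hs.embed : Z →ₗ[ℂ] UniformSpace.Completion hs.PreHilbert) x‖ := fun x => by
    have := hψ x
    rw [← hs.norm_embed] at this
    exact this
  refine ⟨(ψ : Z →ₗ[ℂ] ℂ).extendOfNorm (hs.embed : Z →ₗ[ℂ] UniformSpace.Completion hs.PreHilbert),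
    ContinuousLinearMap.opNorm_le_bound _ hr fun x =>
      LinearMap.norm_extendOfNorm_apply_le hs.denseRange_embed r h x, ?_⟩
  ext x
  exact LinearMap.extendOfNorm_eq hs.denseRange_embed ⟨r, h⟩ x

/-- On functionals dominated by a positive form, an element of the bidual is uniformly
approximated by a vector. -/
lemma exists_approx_bidual (hs : IsPositiveForm s) (F : (Z →L[ℂ] ℂ) →L[ℂ] ℂ) {ε : ℝ}
    (hε : 0 < ε) : ∃ x₀ : Z, ‖x₀‖ ≤ ‖F‖ ∧ ∀ (ψ : Z →L[ℂ] ℂ) (r : ℝ), 0 ≤ r →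
      (∀ x, ‖ψ x‖ ≤ r * √(s x x).re) → ‖F ψ - ψ x₀‖ ≤ r * ε := by
  obtain ⟨h, hh, hrep⟩ := exists_bidual_representation hs.embed F
  obtain ⟨_, ⟨x₀, hx₀, rfl⟩, hdist⟩ := Metric.mem_closure_iff.mp hh ε hε
  refine ⟨x₀, by simpa using hx₀, fun ψ r hr hψ => ?_⟩
  obtain ⟨g, hg, rfl⟩ := hs.exists_extension ψ hr hψ
  rw [hrep, ContinuousLinearMap.comp_apply, ← map_sub]
  rw [dist_eq_norm] at hdist
  exact (g.le_of_opNorm_le hg _).trans (by gcongr)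

/-- A functional dominated by a positive form is approximately represented by a vector. -/
lemma exists_approx_represent (hs : IsPositiveForm s) (ψ : Z →L[ℂ] ℂ) {r ε : ℝ} (hr : 0 ≤ r)
    (hε : 0 < ε) (hψ : ∀ x, ‖ψ x‖ ≤ r * √(s x x).re) :
    ∃ e : Z, ∀ x, ‖ψ x - s x e‖ ≤ ε * √(s x x).re := by
  obtain ⟨g, hg, rfl⟩ := hs.exists_extension ψ hr hψ
  obtain ⟨k, rfl⟩ := (InnerProductSpace.toDual ℂ _).surjective g
  obtain ⟨e, he⟩ := Metric.denseRange_iff.mp hs.denseRange_embed k ε hε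
  refine ⟨e, fun x => ?_⟩
  rw [ContinuousLinearMap.comp_apply, InnerProductSpace.toDual_apply_apply, ← hs.inner_embed,
    ← inner_sub_left, ← hs.norm_embed]
  rw [dist_eq_norm] at he
  exact (norm_inner_le_norm _ _).trans (by gcongr)

/-- Iterated limits can be exchanged for forms dominated by a positive form in one variable. -/
lemma bidual_exchange (hs : IsPositiveForm s) {Y : Type*} [NormedAddCommGroup Y]
    [NormedSpace ℂ Y] {κ : ℂ → ℂ} (hκ : ∀ a b, ‖κ a - κ b‖ = ‖a - b‖) (hκ0 : κ 0 = 0)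
    (F : (Z →L[ℂ] ℂ) →L[ℂ] ℂ) (G : (Y →L[ℂ] ℂ) →L[ℂ] ℂ) {r : ℝ} (hr : 0 ≤ r)
    (u : Z → Y →L[ℂ] ℂ) (v : Y → Z →L[ℂ] ℂ) (w : Z →L[ℂ] ℂ) (m : Y →L[ℂ] ℂ)
    (huv : ∀ f g, u f g = κ (v g f)) (hw : ∀ f, w f = κ (G (u f)))
    (hm : ∀ g, m g = κ (F (v g))) (hv : ∀ g f, ‖v g f‖ ≤ r * ‖g‖ * √(s f f).re) :
    F w = κ (G m) := by
  have hκn (a : ℂ) : ‖κ a‖ = ‖a‖ := by simpa [hκ0] using hκ a 0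
  have key : ∀ ε : ℝ, 0 < ε → ‖F w - κ (G m)‖ ≤ 2 * ‖G‖ * r * ε := by
    intro ε hε
    obtain ⟨f₀, -, h⟩ := hs.exists_approx_bidual F hε
    have h1 : ‖m - u f₀‖ ≤ r * ε := by
      refine ContinuousLinearMap.opNorm_le_bound _ (by positivity) fun g => ?_
      rw [sub_apply, hm, huv, hκ]
      exact (h _ (r * ‖g‖) (by positivity) (hv g)).trans_eq (by ring)
    have h2 : ∀ f, ‖u f‖ ≤ r * √(s f f).re := fun f =>
      ContinuousLinearMap.opNorm_le_bound _ (by positivity) fun g => by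
        rw [huv, hκn]
        exact (hv g f).trans_eq (by ring)
    have h3 : ‖F w - w f₀‖ ≤ ‖G‖ * r * ε := by
      refine h _ _ (by positivity) fun f => ?_
      rw [hw, hκn, mul_assoc]
      exact (G.le_opNorm _).trans (by gcongr; exact h2 f)
    have h4 : ‖w f₀ - κ (G m)‖ ≤ ‖G‖ * r * ε := by
      rw [hw, hκ, ← map_sub]
      rw [norm_sub_rev] at h1
      exact (G.le_opNorm _).trans (by rw [mul_assoc]; gcongr)
    calc _ = ‖(F w - w f₀) + (w f₀ - κ (G m))‖ := by rw [sub_add_sub_cancel]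
      _ ≤ _ := norm_add_le _ _
      _ ≤ _ := by linarith
  refine sub_eq_zero.mp (norm_le_zero_iff.mp (le_of_forall_pos_le_add fun δ hδ => ?_))
  have h5 := key (δ / (2 * ‖G‖ * r + 1)) (by positivity)
  refine h5.trans ?_
  rw [zero_add, ← mul_div_assoc, div_le_iff₀ (by positivity)]
  nlinarith

end IsPositiveForm

end PositiveForms

section NormingForms

variable {𝒜 : Type*} [CStarAlgebra 𝒜]
  {X : Type*} [NormedAddCommGroup X] [NormedSpace ℂ X]
  {Z : Type*} [NormedAddCommGroup Z] [NormedSpace ℂ Z]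

/-- The form `(x, y) ↦ φ ((ρ y)⋆ (ρ x))`. -/
def pullbackForm (φ : 𝒜 →ₗ[ℂ] ℂ) (ρ : X →ₗ[ℂ] 𝒜) : X →ₗ[ℂ] X →ₗ⋆[ℂ] ℂ :=
  LinearMap.mk₂'ₛₗ (RingHom.id ℂ) (starRingEnd ℂ) (fun x y => φ (star (ρ y) * ρ x))
    (fun x y z => by rw [map_add, mul_add, map_add])
    (fun c x y => by rw [map_smul, mul_smul_comm, map_smul]; rfl)
    (fun x y z => by rw [map_add, star_add, add_mul, map_add])
    (fun c x y => by rw [map_smul, star_smul, smul_mul_assoc, map_smul]; rfl)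

lemma pullbackForm_apply (φ : 𝒜 →ₗ[ℂ] ℂ) (ρ : X →ₗ[ℂ] 𝒜) (x y : X) :
    pullbackForm φ ρ x y = φ (star (ρ y) * ρ x) := rfl

/-- The form `(x, y) ↦ φ (L x y)`. -/
def stateForm (φ : 𝒜 →ₗ[ℂ] ℂ) (L : Z →ₗ[ℂ] Z →ₗ⋆[ℂ] 𝒜) : Z →ₗ[ℂ] Z →ₗ⋆[ℂ] ℂ :=
  LinearMap.mk₂'ₛₗ (RingHom.id ℂ) (starRingEnd ℂ) (fun x y => φ (L x y))
    (fun x y z => by rw [LinearMap.map_add₂, map_add])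
    (fun c x y => by rw [LinearMap.map_smul₂, map_smul]; rfl)
    (fun x y z => by rw [map_add, map_add])
    (fun c x y => by rw [map_smulₛₗ, map_smul])

lemma stateForm_apply (φ : 𝒜 →ₗ[ℂ] ℂ) (L : Z →ₗ[ℂ] Z →ₗ⋆[ℂ] 𝒜) (x y : Z) :
    stateForm φ L x y = φ (L x y) := rfl

variable [PartialOrder 𝒜] [StarOrderedRing 𝒜]

namespace IsSubstate

variable {φ : 𝒜 →ₗ[ℂ] ℂ}

lemma sqrt_re_star_mul_self_le (hφ : IsSubstate φ) (a : 𝒜) :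
    √(φ (star a * a)).re ≤ ‖a‖ := by
  rw [Real.sqrt_le_left (norm_nonneg a), sq, ← CStarRing.norm_star_mul_self]
  exact hφ.re_le_norm (star_mul_self_nonneg a)

lemma isPositiveForm_pullbackForm (hφ : IsSubstate φ) {ρ : X →ₗ[ℂ] 𝒜} {M : ℝ}
    (hρ : ∀ x, ‖ρ x‖ ≤ M * ‖x‖) : IsPositiveForm (pullbackForm φ ρ) where
  conj_symm x y := by
    rw [pullbackForm_apply, pullbackForm_apply, ← hφ.map_star, star_mul, star_star]
  re_nonneg x := hφ.re_nonneg _ (star_mul_self_nonneg _)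
  bounded := ⟨M, fun x => (hφ.sqrt_re_star_mul_self_le _).trans (hρ x)⟩

lemma norm_star_mul_le (hφ : IsSubstate φ) (a b : 𝒜) :
    ‖φ (star b * a)‖ ≤ √(φ (star a * a)).re * √(φ (star b * b)).re :=
  (hφ.isPositiveForm_pullbackForm (ρ := LinearMap.id) (M := 1)
    fun x => by simp).norm_le_sqrt a b

lemma norm_apply_le (hφ : IsSubstate φ) (a : 𝒜) : ‖φ a‖ ≤ √(φ (star a * a)).re := by
  have h := hφ.norm_star_mul_le a 1
  rw [star_one, one_mul, one_mul] at h
  refine h.trans (mul_le_of_le_one_right (Real.sqrt_nonneg _) ?_)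
  rw [Real.sqrt_le_left zero_le_one, one_pow]
  exact hφ.re_one_le

end IsSubstate

namespace IsNormingForm

variable {φ : 𝒜 →ₗ[ℂ] ℂ} {L : Z →ₗ[ℂ] Z →ₗ⋆[ℂ] 𝒜}

lemma sqrt_re_le (hL : IsNormingForm L) (hφ : IsSubstate φ) (x : Z) :
    √(φ (L x x)).re ≤ ‖x‖ := by
  rw [Real.sqrt_le_left (norm_nonneg x), sq]
  exact (hφ.re_le_norm (hL.nonneg x)).trans (hL.norm_le x x)

lemma isPositiveForm_stateForm (hL : IsNormingForm L) (hφ : IsSubstate φ) :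
    IsPositiveForm (stateForm φ L) where
  conj_symm x y := by
    rw [stateForm_apply, stateForm_apply, ← hφ.map_star, hL.star_eq]
  re_nonneg x := hφ.re_nonneg _ (hL.nonneg x)
  bounded := ⟨1, fun x => (hL.sqrt_re_le hφ x).trans_eq (one_mul _).symm⟩

lemma isPositiveForm_pullbackForm (hL : IsNormingForm L) (hφ : IsSubstate φ) (e : Z) :
    IsPositiveForm (pullbackForm φ (L.flip e)) :=
  hφ.isPositiveForm_pullbackForm (M := ‖e‖) fun x => (hL.norm_le x e).trans_eq (mul_comm _ _)

/-- The functional `x ↦ φ (L x e)`. -/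
def stateFunctional (hL : IsNormingForm L) (hφ : IsSubstate φ) (e : Z) : Z →L[ℂ] ℂ :=
  LinearMap.mkContinuous ((stateForm φ L).flip e) √(φ (L e e)).re fun x => by
    refine ((hL.isPositiveForm_stateForm hφ).norm_le_sqrt x e).trans ?_
    rw [mul_comm]
    exact mul_le_mul_of_nonneg_left (hL.sqrt_re_le hφ x) (Real.sqrt_nonneg _)

lemma stateFunctional_apply (hL : IsNormingForm L) (hφ : IsSubstate φ) (e x : Z) :
    hL.stateFunctional hφ e x = φ (L x e) := rfl

lemma norm_stateFunctional_le (hL : IsNormingForm L) (hφ : IsSubstate φ) (e : Z) :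
    ‖hL.stateFunctional hφ e‖ ≤ √(φ (L e e)).re :=
  LinearMap.mkContinuous_norm_le _ (Real.sqrt_nonneg _) _

lemma norm_stateFunctional_apply_le (hL : IsNormingForm L) (hφ : IsSubstate φ) (e x : Z) :
    ‖hL.stateFunctional hφ e x‖ ≤ √(φ (L e e)).re * √(φ (L x x)).re :=
  ((hL.isPositiveForm_stateForm hφ).norm_le_sqrt x e).trans_eq (mul_comm _ _)

lemma eq_zero_of_stateFunctional (hL : IsNormingForm L) (K : (Z →L[ℂ] ℂ) →L[ℂ] ℂ)
    (hK : ∀ (φ : 𝒜 →ₗ[ℂ] ℂ) (hφ : IsSubstate φ) (e : Z), K (hL.stateFunctional hφ e) = 0) :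
    K = 0 := by
  have key : ∀ f' : Z →L[ℂ] ℂ, ‖f'‖ ≤ 1 → K f' = 0 := by
    intro f' hf
    obtain ⟨φ, hφ, hle⟩ := hL.exists_substate f' hf
    refine norm_le_zero_iff.mp (le_of_forall_pos_le_add fun δ hδ => ?_)
    obtain ⟨e, he⟩ := (hL.isPositiveForm_stateForm hφ).exists_approx_represent f' zero_le_one
      (ε := δ / (‖K‖ + 1)) (by positivity) fun x => by
        rw [one_mul]
        exact Real.le_sqrt_of_sq_le (hle x)
    have h1 : ‖f' - hL.stateFunctional hφ e‖ ≤ δ / (‖K‖ + 1) :=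
      opNorm_le_bound _ (by positivity) fun x => (he x).trans
        (mul_le_mul_of_nonneg_left (hL.sqrt_re_le hφ x) (by positivity))
    have h2 : K f' = K (f' - hL.stateFunctional hφ e) := by rw [map_sub, hK, sub_zero]
    rw [h2, zero_add]
    refine (K.le_opNorm _).trans ((mul_le_mul_of_nonneg_left h1 (norm_nonneg _)).trans ?_)
    rw [← mul_div_assoc, div_le_iff₀ (by positivity)]
    nlinarith
  ext f'
  rcases eq_or_ne f' 0 with rfl | h
  · simp
  · have h0 : (‖f'‖ : ℂ) ≠ 0 := by exact_mod_cast norm_ne_zero_iff.mpr h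
    have h1 := key ((‖f'‖ : ℂ)⁻¹ • f') (by
      rw [norm_smul, norm_inv, Complex.norm_real, norm_norm,
        inv_mul_cancel₀ (norm_ne_zero_iff.mpr h)])
    rw [map_smul, smul_eq_zero] at h1
    simpa [h0] using h1

variable {P : Z →L[ℂ] Z →SL[starRingEnd ℂ] (Z →L[ℂ] Z)}

section

variable (hL : IsNormingForm L) (hφ : IsSubstate φ)
  (hPn : ∀ x y z, ‖P x y z‖ ≤ ‖x‖ * ‖y‖ * ‖z‖)
  (hP : ∀ h g f e, L (P h g f) e = L h g * L f e)
include hL hφ hP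

include hPn in
lemma norm_stateFunctional_triple_le (e h g f : Z) :
    ‖hL.stateFunctional hφ e (P h g f)‖ ≤ ‖e‖ * ‖f‖ * ‖g‖ * √(φ (L h h)).re := by
  have h1 : L (P h g f) e = L h (P e f g) := by
    rw [hP, ← hL.star_eq (P e f g), hP, star_mul, hL.star_eq, hL.star_eq]
  rw [stateFunctional_apply, h1]
  refine ((hL.isPositiveForm_stateForm hφ).norm_le_sqrt h (P e f g)).trans ?_
  rw [mul_comm]
  exact mul_le_mul_of_nonneg_right ((hL.sqrt_re_le hφ _).trans (hPn e f g)) (Real.sqrt_nonneg _)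

lemma norm_stateFunctional_triple_le_right (e h g f : Z) :
    ‖hL.stateFunctional hφ e (P h g f)‖ ≤
      ‖h‖ * ‖g‖ * √(pullbackForm φ (L.flip e) f f).re := by
  rw [stateFunctional_apply, hP, ← hL.star_eq g h, mul_comm (‖h‖ * ‖g‖)]
  refine (hφ.norm_star_mul_le (L f e) (L g h)).trans ?_
  refine mul_le_mul_of_nonneg_left ?_ (Real.sqrt_nonneg _)
  exact (hφ.sqrt_re_star_mul_self_le _).trans ((hL.norm_le g h).trans_eq (mul_comm _ _))

variable (F G H : (Z →L[ℂ] ℂ) →L[ℂ] ℂ)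

include hPn in
lemma apply_mu2_flip_evalL (e f : Z) :
    H (mu2 (ternaryFlip P) G (_root_.evalL f) (hL.stateFunctional hφ e)) =
      mu2 P G H (hL.stateFunctional hφ e) f := by
  rw [mu2_apply P]
  refine (hL.isPositiveForm_stateForm hφ).bidual_exchange (κ := starRingEnd ℂ) (r := ‖e‖ * ‖f‖)
    (fun a b => by rw [← map_sub, RCLike.norm_conj]) (map_zero _) H G (by positivity)
    (fun h => mu1 (ternaryFlip P) (_root_.evalL f) (hL.stateFunctional hφ e) h)
    (fun g => mu0 P (hL.stateFunctional hφ e) f g) _ (mu1 P H (hL.stateFunctional hφ e) f)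
    (fun h g => ?_) (mu2_apply _ _ _ _) (mu1_apply _ _ _ _) (fun g h => ?_)
  · rw [mu1_apply, _root_.evalL_apply, mu0_apply, mu0_apply, ternaryFlip_apply]
  · rw [mu0_apply, stateForm_apply]
    exact hL.norm_stateFunctional_triple_le hφ hPn hP e h g f

lemma apply_mu2_evalL (e h : Z) :
    F (mu2 P G (_root_.evalL h) (hL.stateFunctional hφ e)) =
      mu2 (ternaryFlip P) G F (hL.stateFunctional hφ e) h := by
  rw [mu2_apply (ternaryFlip P)]
  refine (hL.isPositiveForm_pullbackForm hφ e).bidual_exchange (κ := starRingEnd ℂ) (r := ‖h‖)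
    (fun a b => by rw [← map_sub, RCLike.norm_conj]) (map_zero _) F G (by positivity)
    (fun f => mu1 P (_root_.evalL h) (hL.stateFunctional hφ e) f)
    (fun g => mu0 (ternaryFlip P) (hL.stateFunctional hφ e) h g) _
    (mu1 (ternaryFlip P) F (hL.stateFunctional hφ e) h)
    (fun f g => ?_) (mu2_apply _ _ _ _) (mu1_apply _ _ _ _) (fun g f => ?_)
  · rw [mu1_apply, _root_.evalL_apply, mu0_apply, mu0_apply, ternaryFlip_apply]
  · rw [mu0_apply, ternaryFlip_apply]
    exact hL.norm_stateFunctional_triple_le_right hφ hP e h g f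

include hPn in
lemma arens3_stateFunctional_flip (e : Z) :
    arens3 P H G F (hL.stateFunctional hφ e) =
      arens3 (ternaryFlip P) F G H (hL.stateFunctional hφ e) := by
  rw [arens3_apply, arens3_apply]
  refine ((hL.isPositiveForm_stateForm hφ).bidual_exchange (κ := id) (r := ‖G‖ * ‖e‖)
    (fun _ _ => rfl) rfl H F (by positivity)
    (fun h => mu2 P G (_root_.evalL h) (hL.stateFunctional hφ e))
    (fun f => mu2 (ternaryFlip P) G (_root_.evalL f) (hL.stateFunctional hφ e))
    (mu2 (ternaryFlip P) G F (hL.stateFunctional hφ e)) (mu2 P G H (hL.stateFunctional hφ e))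
    (fun h f => ?_) (fun h => (hL.apply_mu2_evalL hφ hP F G e h).symm)
    (fun f => (hL.apply_mu2_flip_evalL hφ hPn hP G H e f).symm) fun f h => ?_).symm
  · have h1 : mu1 P (_root_.evalL h) (hL.stateFunctional hφ e) f =
        mu1 (ternaryFlip P) (_root_.evalL f) (hL.stateFunctional hφ e) h := by
      ext g
      rw [mu1_apply, mu1_apply, _root_.evalL_apply, _root_.evalL_apply, mu0_apply, mu0_apply,
        ternaryFlip_apply]
    rw [mu2_apply, mu2_apply, h1, id_eq]
  · rw [mu2_apply, RCLike.norm_conj, stateForm_apply, mul_assoc, mul_assoc]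
    refine (G.le_opNorm _).trans (mul_le_mul_of_nonneg_left ?_ (norm_nonneg _))
    refine opNorm_le_bound _ (by positivity) fun g => ?_
    rw [mu1_apply, RCLike.norm_conj, _root_.evalL_apply, mu0_apply, ternaryFlip_apply]
    exact (hL.norm_stateFunctional_triple_le hφ hPn hP e h g f).trans_eq (by ring)

end

lemma arens3_flip (hL : IsNormingForm L) (hPn : ∀ x y z, ‖P x y z‖ ≤ ‖x‖ * ‖y‖ * ‖z‖)
    (hP : ∀ h g f e, L (P h g f) e = L h g * L f e) (F G H : (Z →L[ℂ] ℂ) →L[ℂ] ℂ) :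
    arens3 P H G F = arens3 (ternaryFlip P) F G H :=
  sub_eq_zero.mp <| hL.eq_zero_of_stateFunctional _ fun φ hφ e => by
    rw [sub_apply, hL.arens3_stateFunctional_flip hφ hPn hP F G H, sub_self]

end IsNormingForm

end NormingForms

section CubeIdentity

variable {𝒜 : Type*} [CStarAlgebra 𝒜] [PartialOrder 𝒜] [StarOrderedRing 𝒜]
  {Z : Type*} [NormedAddCommGroup Z] [NormedSpace ℂ Z]

namespace IsNormingForm

variable {φ : 𝒜 →ₗ[ℂ] ℂ} {L : Z →ₗ[ℂ] Z →ₗ⋆[ℂ] 𝒜}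
  {P : Z →L[ℂ] Z →SL[starRingEnd ℂ] (Z →L[ℂ] Z)}

section

variable (hL : IsNormingForm L) (hφ : IsSubstate φ)

lemma norm_stateFunctional_apply_le_pullbackForm (e f : Z) :
    ‖hL.stateFunctional hφ e f‖ ≤ √(pullbackForm φ (L.flip e) f f).re :=
  hφ.norm_apply_le (L f e)

variable (hPn : ∀ x y z, ‖P x y z‖ ≤ ‖x‖ * ‖y‖ * ‖z‖)
  (hP : ∀ h g f e, L (P h g f) e = L h g * L f e)
  (F G H : (Z →L[ℂ] ℂ) →L[ℂ] ℂ)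
include hP

include hPn in
lemma norm_mu2_flip_apply_le (e h : Z) :
    ‖mu2 (ternaryFlip P) G F (hL.stateFunctional hφ e) h‖ ≤
      ‖G‖ * (‖F‖ * ‖e‖) * √(stateForm φ L h h).re := by
  rw [mu2_apply, RCLike.norm_conj, mul_assoc]
  refine (G.le_opNorm _).trans (mul_le_mul_of_nonneg_left ?_ (norm_nonneg _))
  refine opNorm_le_bound _ (by positivity) fun g => ?_
  rw [mu1_apply, RCLike.norm_conj, mul_assoc, mul_assoc]
  refine (F.le_opNorm _).trans (mul_le_mul_of_nonneg_left ?_ (norm_nonneg _))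
  refine opNorm_le_bound _ (by positivity) fun f => ?_
  rw [mu0_apply, ternaryFlip_apply, stateForm_apply]
  exact (hL.norm_stateFunctional_triple_le hφ hPn hP e h g f).trans_eq (by ring)

lemma norm_mu2_evalL_apply_le (e h f : Z) :
    ‖mu2 P G (_root_.evalL h) (hL.stateFunctional hφ e) f‖ ≤
      ‖G‖ * ‖h‖ * √(pullbackForm φ (L.flip e) f f).re := by
  rw [mu2_apply, RCLike.norm_conj, mul_assoc]
  refine (G.le_opNorm _).trans (mul_le_mul_of_nonneg_left ?_ (norm_nonneg _))
  refine opNorm_le_bound _ (by positivity) fun g => ?_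
  rw [mu1_apply, RCLike.norm_conj, _root_.evalL_apply, mu0_apply]
  exact (hL.norm_stateFunctional_triple_le_right hφ hP e h g f).trans_eq (by ring)

lemma norm_mu1_evalL_apply_le (e f g : Z) :
    ‖mu1 P (_root_.evalL e) (hL.stateFunctional hφ e) f g‖ ≤
      ‖f‖ * ‖e‖ * √(pullbackForm φ (L.flip e) g g).re := by
  rw [mu1_apply, RCLike.norm_conj, _root_.evalL_apply, mu0_apply, stateFunctional_apply, hP,
    ← hL.star_eq g e, mul_comm (‖f‖ * ‖e‖)]
  refine (hφ.norm_star_mul_le (L f e) (L g e)).trans ?_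
  rw [mul_comm]
  refine mul_le_mul_of_nonneg_left ?_ (Real.sqrt_nonneg _)
  exact (hφ.sqrt_re_star_mul_self_le _).trans (hL.norm_le f e)

lemma sq_norm_le_mu1_evalL (e f : Z) :
    ‖hL.stateFunctional hφ e f‖ ^ 2 ≤
      ‖mu1 P (_root_.evalL e) (hL.stateFunctional hφ e) f f‖ := by
  rw [mu1_apply, RCLike.norm_conj, _root_.evalL_apply, mu0_apply, stateFunctional_apply,
    stateFunctional_apply, hP, ← hL.star_eq f e]
  refine (pow_le_pow_left₀ (norm_nonneg _) (hφ.norm_apply_le (L f e)) 2).trans ?_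
  rw [Real.sq_sqrt (hφ.re_nonneg _ (star_mul_self_nonneg _))]
  exact Complex.re_le_norm _

include hL hφ hPn in
/-- The estimates obtained by approximating an element of the bidual by two vectors. -/
lemma exists_cube_estimate {f' : Z →L[ℂ] ℂ} (hf : ∀ x, ‖f' x‖ ^ 2 ≤ (φ (L x x)).re)
    {ε : ℝ} (hε : 0 < ε) : ∃ p b : ℝ, 0 ≤ p ∧ p ≤ ‖F‖ ∧ 0 ≤ b ∧ b ≤ ‖F‖ ^ 2 ∧
      ‖F f'‖ ≤ p + ε ∧ p ^ 2 ≤ b + (‖F‖ + 1) * ε ∧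
      b ^ 2 ≤ ‖arens3 P F F F‖ * p + (‖F‖ ^ 3 + 2 * ‖F‖ ^ 2) * ε := by
  obtain ⟨x, hx, hxF⟩ := (hL.isPositiveForm_stateForm hφ).exists_approx_bidual F hε
  obtain ⟨y, hy, hyF⟩ := (hL.isPositiveForm_pullbackForm hφ x).exists_approx_bidual F hε
  set N := ‖F‖ with hN
  have hN0 : 0 ≤ N := norm_nonneg F
  set p := √(φ (L x x)).re with hp
  set ψ := hL.stateFunctional hφ x with hψ
  have hp0 : 0 ≤ p := Real.sqrt_nonneg _
  have hpN : p ≤ N := (hL.sqrt_re_le hφ x).trans hx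
  have hψp : ‖ψ‖ ≤ p := hL.norm_stateFunctional_le hφ x
  have h1 : ‖F f' - f' x‖ ≤ 1 * ε := hxF f' 1 zero_le_one fun z => by
    rw [one_mul]
    exact Real.le_sqrt_of_sq_le (hf z)
  have h2 : ‖f' x‖ ≤ p := Real.le_sqrt_of_sq_le (hf x)
  have h3 : ‖F ψ - ψ x‖ ≤ p * ε :=
    hxF ψ p hp0 fun z => hL.norm_stateFunctional_apply_le hφ x z
  have h4 : p ^ 2 ≤ ‖ψ x‖ := by
    rw [hp, Real.sq_sqrt (hφ.re_nonneg _ (hL.nonneg x))]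
    exact Complex.re_le_norm _
  have h5 : ‖F ψ - ψ y‖ ≤ 1 * ε := hyF ψ 1 zero_le_one fun z => by
    rw [one_mul]
    exact hL.norm_stateFunctional_apply_le_pullbackForm hφ x z
  have h6 : ‖arens3 P F F F ψ - mu2 (ternaryFlip P) F F ψ x‖ ≤ N * (N * ‖x‖) * ε := by
    rw [hL.arens3_stateFunctional_flip hφ hPn hP, arens3_apply]
    exact hxF _ _ (by positivity) fun z => hL.norm_mu2_flip_apply_le hφ hPn hP F F x z
  have h7 : ‖mu2 (ternaryFlip P) F F ψ x - mu2 P F (_root_.evalL x) ψ y‖ ≤ N * ‖x‖ * ε := by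
    rw [← hL.apply_mu2_evalL hφ hP]
    exact hyF _ _ (by positivity) fun z => hL.norm_mu2_evalL_apply_le hφ hP F x x z
  have h8 : ‖F (mu1 P (_root_.evalL x) ψ y) - mu1 P (_root_.evalL x) ψ y y‖ ≤
      ‖y‖ * ‖x‖ * ε :=
    hyF _ _ (by positivity) fun z => hL.norm_mu1_evalL_apply_le hφ hP x y z
  have h9 : ‖ψ y‖ ^ 2 ≤ ‖mu1 P (_root_.evalL x) ψ y y‖ := hL.sq_norm_le_mu1_evalL hφ hP x y
  have h10 : ‖mu2 P F (_root_.evalL x) ψ y‖ = ‖F (mu1 P (_root_.evalL x) ψ y)‖ := by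
    rw [mu2_apply, RCLike.norm_conj]
  have h11 : ‖arens3 P F F F ψ‖ ≤ ‖arens3 P F F F‖ * p :=
    ((arens3 P F F F).le_opNorm ψ).trans (mul_le_mul_of_nonneg_left hψp (norm_nonneg _))
  have h12 : N * (N * ‖x‖) * ε ≤ N ^ 3 * ε := by
    calc _ ≤ N * (N * N) * ε := by gcongr
      _ = _ := by ring
  have h13 : N * ‖x‖ * ε ≤ N ^ 2 * ε := by
    calc _ ≤ N * N * ε := by gcongr
      _ = _ := by ring
  have h14 : ‖y‖ * ‖x‖ * ε ≤ N ^ 2 * ε := by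
    calc _ ≤ N * N * ε := by gcongr
      _ = _ := by ring
  have h15 : p * ε ≤ N * ε := by gcongr
  have n1 := norm_sub_norm_le (F f') (f' x)
  have n2 := norm_sub_norm_le (ψ x) (F ψ)
  rw [norm_sub_rev] at n2
  have n3 := norm_sub_norm_le (F ψ) (ψ y)
  have n4 := norm_sub_norm_le (mu2 (ternaryFlip P) F F ψ x) (arens3 P F F F ψ)
  rw [norm_sub_rev] at n4
  have n5 := norm_sub_norm_le (mu2 P F (_root_.evalL x) ψ y) (mu2 (ternaryFlip P) F F ψ x)
  rw [norm_sub_rev] at n5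
  have n6 := norm_sub_norm_le (mu1 P (_root_.evalL x) ψ y y) (F (mu1 P (_root_.evalL x) ψ y))
  rw [norm_sub_rev] at n6
  refine ⟨p, ‖ψ y‖, hp0, hpN, norm_nonneg _, ?_, by linarith, by linarith, by linarith⟩
  calc ‖ψ y‖ ≤ ‖ψ‖ * ‖y‖ := ψ.le_opNorm y
    _ ≤ N * N := by
      gcongr
      exact hψp.trans hpN
    _ = N ^ 2 := by ring

end

lemma pow_three_le_of_lt (hL : IsNormingForm L)
    (hPn : ∀ x y z, ‖P x y z‖ ≤ ‖x‖ * ‖y‖ * ‖z‖)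
    (hP : ∀ h g f e, L (P h g f) e = L h g * L f e) (F : (Z →L[ℂ] ℂ) →L[ℂ] ℂ) {c : ℝ}
    (hc : 0 < c) (hcF : c < ‖F‖) : c ^ 3 ≤ ‖arens3 P F F F‖ := by
  obtain ⟨f', hf, hcf⟩ := F.exists_lt_apply_of_lt_opNorm hcF
  obtain ⟨φ, hφ, hle⟩ := hL.exists_substate f' hf.le
  set M := ‖arens3 P F F F‖
  set N := ‖F‖
  have hN0 : 0 ≤ N := norm_nonneg F
  by_contra! hM
  set K : ℝ := N ^ 3 + 2 * N ^ 2 + 2 * N ^ 2 * (N + 1) + (N + 1) ^ 2 with hK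
  have hKpos : 0 < K := by positivity
  set ε := min (min 1 (‖F f'‖ - c)) (c * (c ^ 3 - M) / (2 * K)) with hεdef
  have hd : 0 < c * (c ^ 3 - M) := mul_pos hc (by linarith)
  have hε : 0 < ε := lt_min (lt_min one_pos (by linarith)) (by positivity)
  have hε1 : ε ≤ 1 := (min_le_left _ _).trans (min_le_left _ _)
  have hε2 : ε ≤ ‖F f'‖ - c := (min_le_left _ _).trans (min_le_right _ _)
  have hε3 : ε * (2 * K) ≤ c * (c ^ 3 - M) :=
    (le_div_iff₀ (by positivity)).mp (min_le_right _ _)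
  obtain ⟨p, b, hp0, hpN, hb0, hbN, h1, h2, h3⟩ := hL.exists_cube_estimate hφ hPn hP F hle hε
  have hcp : c ≤ p := by linarith
  have h4 : p ^ 4 ≤ M * p + K * ε := by
    calc p ^ 4 = (p ^ 2) ^ 2 := by ring
      _ ≤ (b + (N + 1) * ε) ^ 2 := by gcongr
      _ = b ^ 2 + 2 * b * (N + 1) * ε + (N + 1) ^ 2 * (ε * ε) := by ring
      _ ≤ (M * p + (N ^ 3 + 2 * N ^ 2) * ε) + 2 * N ^ 2 * (N + 1) * ε
          + (N + 1) ^ 2 * (ε * 1) := by gcongr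
      _ = M * p + K * ε := by rw [hK]; ring
  have h5 : c * (c ^ 3 - M) ≤ p * (p ^ 3 - M) := by
    have : c ^ 3 ≤ p ^ 3 := by gcongr
    exact mul_le_mul hcp (by linarith) (by linarith) hp0
  nlinarith

/-- The cube identity for the Arens extension of a positive triple product, in the non-trivial
direction. -/
lemma pow_three_norm_le_norm_arens3 (hL : IsNormingForm L)
    (hPn : ∀ x y z, ‖P x y z‖ ≤ ‖x‖ * ‖y‖ * ‖z‖)
    (hP : ∀ h g f e, L (P h g f) e = L h g * L f e) (F : (Z →L[ℂ] ℂ) →L[ℂ] ℂ) :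
    ‖F‖ ^ 3 ≤ ‖arens3 P F F F‖ := by
  rcases (norm_nonneg F).eq_or_lt with h | h
  · rw [← h]
    simp
  · have hev : ∀ᶠ c in nhdsWithin ‖F‖ (Set.Iio ‖F‖), c ^ 3 ≤ ‖arens3 P F F F‖ := by
      filter_upwards [Ioo_mem_nhdsLT h] with c hc
      exact hL.pow_three_le_of_lt hPn hP F hc.1 hc.2
    exact le_of_tendsto (((continuous_id.pow 3).tendsto ‖F‖).mono_left nhdsWithin_le_nhds) hev

end IsNormingForm

end CubeIdentity

section BidualTernary

variable {Z : Type*} [NormedAddCommGroup Z] [NormedSpace ℂ Z]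
  {T : Z →L[ℂ] Z →SL[starRingEnd ℂ] (Z →L[ℂ] Z)}

lemma arens3_comp_apply {P : Z →L[ℂ] Z →SL[starRingEnd ℂ] (Z →L[ℂ] Z)} {J : Z →L[ℂ] Z}
    (hJ : ∀ x y z, P x y z = J (T x y z)) (H G F : (Z →L[ℂ] ℂ) →L[ℂ] ℂ) (f' : Z →L[ℂ] ℂ) :
    arens3 P H G F f' = arens3 T H G F (f'.comp J) := by
  have h0 (f g : Z) : mu0 P f' f g = mu0 T (f'.comp J) f g := by
    ext h
    rw [mu0_apply, mu0_apply, hJ, comp_apply]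
  have h1 (f : Z) : mu1 P H f' f = mu1 T H (f'.comp J) f := by
    ext g
    rw [mu1_apply, mu1_apply, h0]
  rw [arens3_apply, arens3_apply]
  congr 1
  ext f
  rw [mu2_apply, mu2_apply, h1]

lemma arens3_arens3_left_eq_right
    (hassoc : ∀ v w x y z : Z, T (T v w x) y z = T v w (T x y z))
    (U V W X Y : (Z →L[ℂ] ℂ) →L[ℂ] ℂ) :
    arens3 T (arens3 T V W X) Y U = arens3 T V W (arens3 T X Y U) := by
  ext f'
  rw [arens3_apply, arens3_apply, arens3_apply]
  congr 1
  ext u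
  rw [mu2_apply, mu2_apply]
  congr 2
  ext y
  rw [mu1_apply, mu1_apply, arens3_apply]
  congr 2
  ext x
  rw [mu0_apply, mu2_apply, mu2_apply]
  congr 2
  ext w
  rw [mu1_apply, mu1_apply]
  congr 2
  ext v
  simp only [mu0_apply]
  rw [hassoc]

lemma arens3_arens3_left_eq_mid
    (hassoc : ∀ v w x y z : Z, T (T v w x) y z = T v (T y x w) z)
    (hflip : ∀ F G H, arens3 T H G F = arens3 (ternaryFlip T) F G H)
    (U V W X Y : (Z →L[ℂ] ℂ) →L[ℂ] ℂ) :
    arens3 T (arens3 T V W X) Y U = arens3 T V (arens3 T Y X W) U := by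
  ext f'
  rw [arens3_apply, arens3_apply]
  congr 1
  ext u
  rw [mu2_apply, mu2_apply, hflip W X Y, arens3_apply]
  congr 2
  ext y
  rw [mu1_apply, mu2_apply, arens3_apply]
  congr 2
  ext x
  rw [mu2_apply, mu1_apply]
  congr 2
  ext w
  rw [mu0_apply, ternaryFlip_apply, mu1_apply, mu1_apply]
  congr 2
  ext v
  simp only [mu0_apply]
  rw [hassoc]

lemma norm_arens3_le (hT : ∀ x y z, ‖T x y z‖ ≤ ‖x‖ * ‖y‖ * ‖z‖)
    (H G F : (Z →L[ℂ] ℂ) →L[ℂ] ℂ) : ‖arens3 T H G F‖ ≤ ‖H‖ * ‖G‖ * ‖F‖ := by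
  have h1 : ‖T‖ ≤ 1 := opNorm_le_bound _ zero_le_one fun x =>
    opNorm_le_bound _ (by positivity) fun y => opNorm_le_bound _ (by positivity) fun z =>
      (hT x y z).trans_eq (by ring)
  refine (LinearMap.mkContinuous_norm_le _ (by positivity) _).trans ?_
  calc ‖F‖ * (‖G‖ * (‖H‖ * ‖T‖)) ≤ ‖F‖ * (‖G‖ * (‖H‖ * 1)) := by gcongr
    _ = _ := by ring

variable (T) [CompleteSpace Z] [IsCStarTernary T]

/-- Every C*-ternary ring carries an isometric involution that turns it into a positive one. -/
lemma exists_positive_triple : ∃ (J : Z →L[ℂ] Z) (P : Z →L[ℂ] Z →SL[starRingEnd ℂ] (Z →L[ℂ] Z))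
    (L : Z →ₗ[ℂ] Z →ₗ⋆[ℂ] adjointable T), (∀ x, J (J x) = x) ∧ (∀ x, ‖J x‖ = ‖x‖) ∧
      (∀ x y z, P x y z = J (T x y z)) ∧ IsNormingForm L ∧
      ∀ h g f e, L (P h g f) e = L h g * L f e := by
  obtain ⟨J, hJJ, hJn, h1, h2, h3, hpos⟩ := exists_ternarySymmetry T
  have hL (x y : Z) : leftMul T (J x) y = leftMul T x (J y) := by
    ext z
    exact h1 x y z
  refine ⟨J, T.comp J, (leftMul T).comp (J : Z →ₗ[ℂ] Z), hJJ, hJn, fun x y z => ?_,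
    ⟨fun x y => ?_, hpos, fun x y => ?_, fun x => ?_⟩, fun h g f e => ?_⟩
  · rw [comp_apply, h1, h2, h3]
  · change star (leftMul T (J x) y) = leftMul T (J y) x
    rw [star_leftMul, hL]
  · change ‖leftMul T (J x) y‖ ≤ _
    rw [← hJn x]
    exact norm_leftMul_le _ _
  · change _ ≤ ‖leftMul T (J x) x‖
    rcases (norm_nonneg x).eq_or_lt with h0 | h0
    · rw [← h0]
      simp
    · refine le_of_mul_le_mul_right ?_ h0
      calc ‖x‖ ^ 2 * ‖x‖ = ‖x‖ ^ 3 := by ring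
        _ = ‖T (J x) x x‖ := by rw [h1, h2, h3, hJn, IsCStarTernary.norm_cube (T := T)]
        _ ≤ _ := norm_adjointable_apply_le (leftMul T (J x) x) x
  · change leftMul T (J (T (J h) g f)) e = leftMul T (J h) g * leftMul T (J f) e
    rw [leftMul_mul_leftMul, h3]

lemma arens3_eq_arens3_ternaryFlip (F G H : (Z →L[ℂ] ℂ) →L[ℂ] ℂ) :
    arens3 T H G F = arens3 (ternaryFlip T) F G H := by
  obtain ⟨J, P, L, hJJ, hJn, hPJ, hL, hP⟩ := exists_positive_triple T
  have hPn (x y z : Z) : ‖P x y z‖ ≤ ‖x‖ * ‖y‖ * ‖z‖ := by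
    rw [hPJ, hJn]
    exact IsCStarTernary.norm_le x y z
  have h := hL.arens3_flip hPn hP F G H
  ext f'
  have hf : f' = (f'.comp J).comp J := by
    ext x
    rw [comp_apply, comp_apply, hJJ]
  have hPJ' : ∀ x y z, ternaryFlip P x y z = J (ternaryFlip T x y z) := fun x y z => hPJ z y x
  rw [hf, ← arens3_comp_apply hPJ, ← arens3_comp_apply hPJ', h]

lemma pow_three_norm_le_norm_arens3 (F : (Z →L[ℂ] ℂ) →L[ℂ] ℂ) :
    ‖F‖ ^ 3 ≤ ‖arens3 T F F F‖ := by
  obtain ⟨J, P, L, hJJ, hJn, hPJ, hL, hP⟩ := exists_positive_triple T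
  have hPn (x y z : Z) : ‖P x y z‖ ≤ ‖x‖ * ‖y‖ * ‖z‖ := by
    rw [hPJ, hJn]
    exact IsCStarTernary.norm_le x y z
  refine (hL.pow_three_norm_le_norm_arens3 hPn hP F).trans
    (opNorm_le_bound _ (norm_nonneg _) fun f' => ?_)
  rw [arens3_comp_apply hPJ]
  refine (le_opNorm _ _).trans (mul_le_mul_of_nonneg_left ?_ (norm_nonneg _))
  refine opNorm_le_bound _ (norm_nonneg _) fun x => ?_
  rw [comp_apply, ← hJn x]
  exact f'.le_opNorm _

end BidualTernary

/-- Let `Z` be a C*-ternary ring (a complex Banach space with a bounded triple product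
`[x y z] = T x y z`, linear in the outer variables, conjugate-linear in the middle
variable, associative in the sense that `[[v w x] y z] = [v [y x w] z] = [v w [x y z]]`,
with `‖[x y z]‖ ≤ ‖x‖‖y‖‖z‖` and `‖[x x x]‖ = ‖x‖³`).  Then the bidual `Z″`, equipped
with the bidual norm and the Arens extension of the triple product, is again a C*-ternary
ring: the extended product is linear in the outer variables, conjugate-linear in the
middle variable, associative in the same sense, and satisfies `‖[H G F]‖ ≤ ‖H‖‖G‖‖F‖` and
`‖[F F F]‖ = ‖F‖³`. -/
theorem cstarTernary_bidual_is_cstarTernary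
    {Z : Type*} [NormedAddCommGroup Z] [NormedSpace ℂ Z] [CompleteSpace Z]
    (T : Z →L[ℂ] Z →SL[starRingEnd ℂ] (Z →L[ℂ] Z))
    (hassoc₁ : ∀ v w x y z : Z, T (T v w x) y z = T v (T y x w) z)
    (hassoc₂ : ∀ v w x y z : Z, T (T v w x) y z = T v w (T x y z))
    (hnorm : ∀ x y z : Z, ‖T x y z‖ ≤ ‖x‖ * ‖y‖ * ‖z‖)
    (hcube : ∀ x : Z, ‖T x x x‖ = ‖x‖ ^ 3) :
    (∀ (H G F₁ F₂ : (Z →L[ℂ] ℂ) →L[ℂ] ℂ),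
      arens3 T H G (F₁ + F₂) = arens3 T H G F₁ + arens3 T H G F₂) ∧
    (∀ (H G F : (Z →L[ℂ] ℂ) →L[ℂ] ℂ) (c : ℂ),
      arens3 T H G (c • F) = c • arens3 T H G F) ∧
    (∀ (H₁ H₂ G F : (Z →L[ℂ] ℂ) →L[ℂ] ℂ),
      arens3 T (H₁ + H₂) G F = arens3 T H₁ G F + arens3 T H₂ G F) ∧
    (∀ (H G F : (Z →L[ℂ] ℂ) →L[ℂ] ℂ) (c : ℂ),
      arens3 T (c • H) G F = c • arens3 T H G F) ∧
    (∀ (H G₁ G₂ F : (Z →L[ℂ] ℂ) →L[ℂ] ℂ),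
      arens3 T H (G₁ + G₂) F = arens3 T H G₁ F + arens3 T H G₂ F) ∧
    (∀ (H G F : (Z →L[ℂ] ℂ) →L[ℂ] ℂ) (c : ℂ),
      arens3 T H (c • G) F = (starRingEnd ℂ) c • arens3 T H G F) ∧
    (∀ (U V W X Y : (Z →L[ℂ] ℂ) →L[ℂ] ℂ),
      arens3 T (arens3 T V W X) Y U = arens3 T V (arens3 T Y X W) U ∧
      arens3 T (arens3 T V W X) Y U = arens3 T V W (arens3 T X Y U)) ∧
    (∀ (H G F : (Z →L[ℂ] ℂ) →L[ℂ] ℂ),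
      ‖arens3 T H G F‖ ≤ ‖H‖ * ‖G‖ * ‖F‖) ∧
    (∀ F : (Z →L[ℂ] ℂ) →L[ℂ] ℂ, ‖arens3 T F F F‖ = ‖F‖ ^ 3) := by
  have hT : IsCStarTernary T := ⟨hassoc₁, hassoc₂, hnorm, hcube⟩
  have h0 (H₁ H₂ : (Z →L[ℂ] ℂ) →L[ℂ] ℂ) (f' : Z →L[ℂ] ℂ) (f : Z) :
      mu1 T (H₁ + H₂) f' f = mu1 T H₁ f' f + mu1 T H₂ f' f := by
    ext g; simp
  have h0' (H : (Z →L[ℂ] ℂ) →L[ℂ] ℂ) (c : ℂ) (f' : Z →L[ℂ] ℂ) (f : Z) :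
      mu1 T (c • H) f' f = (starRingEnd ℂ) c • mu1 T H f' f := by
    ext g; simp
  have h1 (G H₁ H₂ : (Z →L[ℂ] ℂ) →L[ℂ] ℂ) (f' : Z →L[ℂ] ℂ) :
      mu2 T G (H₁ + H₂) f' = mu2 T G H₁ f' + mu2 T G H₂ f' := by
    ext f; simp [h0]
  have h1' (G H : (Z →L[ℂ] ℂ) →L[ℂ] ℂ) (c : ℂ) (f' : Z →L[ℂ] ℂ) :
      mu2 T G (c • H) f' = c • mu2 T G H f' := by
    ext f; simp [h0']
  have h2 (G₁ G₂ H : (Z →L[ℂ] ℂ) →L[ℂ] ℂ) (f' : Z →L[ℂ] ℂ) :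
      mu2 T (G₁ + G₂) H f' = mu2 T G₁ H f' + mu2 T G₂ H f' := by
    ext f; simp
  have h2' (G H : (Z →L[ℂ] ℂ) →L[ℂ] ℂ) (c : ℂ) (f' : Z →L[ℂ] ℂ) :
      mu2 T (c • G) H f' = (starRingEnd ℂ) c • mu2 T G H f' := by
    ext f; simp
  refine ⟨fun H G F₁ F₂ => rfl, fun H G F c => rfl, fun H₁ H₂ G F => ?_, fun H G F c => ?_,
    fun H G₁ G₂ F => ?_, fun H G F c => ?_, fun U V W X Y => ⟨?_, ?_⟩,
    norm_arens3_le hnorm, fun F => le_antisymm ?_ (pow_three_norm_le_norm_arens3 T F)⟩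
  · ext f'; simp [h1]
  · ext f'; simp [h1']
  · ext f'; simp [h2]
  · ext f'; simp [h2']
  · exact arens3_arens3_left_eq_mid hassoc₁ (arens3_eq_arens3_ternaryFlip T) U V W X Y
  · exact arens3_arens3_left_eq_right hassoc₂ U V W X Y
  · exact (norm_arens3_le hnorm F F F).trans_eq (by ring)

end
end

section
/- Let Z be a C*-ternary ring and J ⊆ Z a closed linear subspace which is a ternary ideal, i.e. [x y z] ∈ J whenever at least one of x, y, z lies in J (and the others in Z). Then the quotient Banach space Z/J carries a well-defined triple product [x+J, y+J, z+J] := [x y z] + J, and with this product and the quotient norm Z/J is again a C*-ternary ring; in particular ‖[x̄ ȳ z̄]‖ ≤ ‖x̄‖‖ȳ‖‖z̄‖ and ‖[x̄ x̄ x̄]‖ = ‖x̄‖³ for all x̄, ȳ, z̄ ∈ Z/J. -/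
/-- A C*-ternary ring: a complex Banach space `Z` (completeness is imposed where needed)
with a triple product `[x y z] = t x y z`, linear in the outer variables, conjugate-linear in
the middle variable, associative in the sense that
`[[v w x] y z] = [v [y x w] z] = [v w [x y z]]`, and satisfying
`‖[x y z]‖ ≤ ‖x‖‖y‖‖z‖` and `‖[x x x]‖ = ‖x‖³`. -/
structure CstarTernary (Z : Type*) [NormedAddCommGroup Z] [NormedSpace ℂ Z] where
  t : Z → Z → Z → Z
  add_left : ∀ x w y z, t (x + w) y z = t x y z + t w y z
  smul_left : ∀ (c : ℂ) (x y z), t (c • x) y z = c • t x y z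
  add_mid : ∀ x y w z, t x (y + w) z = t x y z + t x w z
  smul_mid : ∀ (c : ℂ) (x y z), t x (c • y) z = (starRingEnd ℂ) c • t x y z
  add_right : ∀ x y z w, t x y (z + w) = t x y z + t x y w
  smul_right : ∀ (c : ℂ) (x y z), t x y (c • z) = c • t x y z
  assoc₁ : ∀ v w x y z, t (t v w x) y z = t v (t y x w) z
  assoc₂ : ∀ v w x y z, t (t v w x) y z = t v w (t x y z)
  norm_le : ∀ x y z, ‖t x y z‖ ≤ ‖x‖ * ‖y‖ * ‖z‖
  norm_cube : ∀ x, ‖t x x x‖ = ‖x‖ ^ 3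

namespace CstarTernary

variable {Z : Type*} [NormedAddCommGroup Z] [NormedSpace ℂ Z] (S : CstarTernary Z)

lemma zero_left (y z : Z) : S.t 0 y z = 0 := by
  simpa using S.smul_left 0 0 y z

lemma zero_mid (x z : Z) : S.t x 0 z = 0 := by
  simpa using S.smul_mid 0 x 0 z

lemma zero_right (x y : Z) : S.t x y 0 = 0 := by
  simpa using S.smul_right 0 x y 0

lemma sub_left (x w y z : Z) : S.t (x - w) y z = S.t x y z - S.t w y z := by
  rw [eq_sub_iff_add_eq, ← S.add_left, sub_add_cancel]

lemma sub_mid (x y w z : Z) : S.t x (y - w) z = S.t x y z - S.t x w z := by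
  rw [eq_sub_iff_add_eq, ← S.add_mid, sub_add_cancel]

lemma sub_right (x y z w : Z) : S.t x y (z - w) = S.t x y z - S.t x y w := by
  rw [eq_sub_iff_add_eq, ← S.add_right, sub_add_cancel]

/-- The operator `x ↦ [x k k]`. -/
noncomputable def rightMul (k : Z) : Z →L[ℂ] Z :=
  LinearMap.mkContinuous
    { toFun := fun x => S.t x k k
      map_add' := fun x y => S.add_left x y k k
      map_smul' := fun c x => S.smul_left c x k k } (‖k‖ * ‖k‖) fun x => by
      simpa [mul_comm, mul_assoc, mul_left_comm] using S.norm_le x k k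

lemma norm_rightMul_le (k : Z) : ‖S.rightMul k‖ ≤ ‖k‖ * ‖k‖ :=
  LinearMap.mkContinuous_norm_le _ (by positivity) _

/-- An operator commuting with all left multiplications `z ↦ [x y z]`. -/
def CommutesLeft (r : Z →L[ℂ] Z) : Prop := ∀ x y z, S.t x y (r z) = r (S.t x y z)

/-- The operator `s` is an adjoint of `r` with respect to the triple product. -/
def IsAdjoint (r s : Z →L[ℂ] Z) : Prop := ∀ x y z, S.t x (r y) z = S.t (s x) y z

variable {S}

lemma CommutesLeft.pow {u : Z →L[ℂ] Z} (hu : S.CommutesLeft u) (n : ℕ) :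
    S.CommutesLeft (u ^ n) := by
  induction n with
  | zero => intro x y z; simp
  | succ n ih =>
    intro x y z
    rw [pow_succ]
    simp only [mul_apply_eq_comp]
    rw [ih, hu]

lemma CommutesLeft.sum_pow {u : Z →L[ℂ] Z} (hu : S.CommutesLeft u) (n : ℕ) :
    S.CommutesLeft (∑ j ∈ Finset.range n, u ^ j) := by
  induction n with
  | zero => intro x y z; simp [S.zero_right]
  | succ n ih =>
    intro x y z
    rw [Finset.sum_range_succ]
    simp only [add_apply]
    rw [S.add_right, ih, hu.pow n]

lemma CommutesLeft.smul {r : Z →L[ℂ] Z} (hr : S.CommutesLeft r) (c : ℂ) :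
    S.CommutesLeft (c • r) := by
  intro x y z
  simp only [smul_apply]
  rw [S.smul_right, hr]

lemma IsAdjoint.pow {u w : Z →L[ℂ] Z} (h : S.IsAdjoint u w) (n : ℕ) :
    S.IsAdjoint (u ^ n) (w ^ n) := by
  induction n with
  | zero => intro x y z; simp
  | succ n ih =>
    intro x y z
    rw [pow_succ u, pow_succ' w]
    simp only [mul_apply_eq_comp]
    rw [ih, h]

lemma IsAdjoint.sum_pow {u w : Z →L[ℂ] Z} (h : S.IsAdjoint u w) (n : ℕ) :
    S.IsAdjoint (∑ j ∈ Finset.range n, u ^ j) (∑ j ∈ Finset.range n, w ^ j) := by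
  induction n with
  | zero => intro x y z; simp [S.zero_left, S.zero_mid]
  | succ n ih =>
    intro x y z
    rw [Finset.sum_range_succ, Finset.sum_range_succ]
    simp only [add_apply]
    rw [S.add_mid, S.add_left, ih, h.pow n]

lemma IsAdjoint.smul {r s : Z →L[ℂ] Z} (h : S.IsAdjoint r s) (c : ℂ) :
    S.IsAdjoint (c • r) ((starRingEnd ℂ) c • s) := by
  intro x y z
  simp only [smul_apply]
  rw [S.smul_mid, S.smul_left, h]

/-- An adjointable contraction `r` commuting with left multiplications satisfies
`‖r x‖³ ≤ ‖r [x x x]‖`. -/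
lemma norm_cube_le {r s : Z →L[ℂ] Z} (hr : S.CommutesLeft r) (h : S.IsAdjoint r s)
    (hn : ∀ x, ‖r x‖ ≤ ‖x‖) (x : Z) : ‖r x‖ ^ 3 ≤ ‖r (S.t x x x)‖ := by
  set v := S.t (s (r x)) x x with hv
  have h1 : ‖r x‖ ^ 3 ≤ ‖v‖ := by
    rw [← S.norm_cube, hr, h]
    exact hn _
  have h2 : S.t v v v = S.t (r x) (S.t (r x) (r x) (r (S.t x x x))) v := by
    have e : S.t v x x = S.t (s (r x)) x (S.t x x x) := by rw [hv, S.assoc₂]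
    calc S.t v v v = S.t (s (r x)) (S.t v x x) v := by
          conv_lhs => rw [hv, S.assoc₁, ← hv]
      _ = S.t (r x) (r (S.t v x x)) v := (h _ _ _).symm
      _ = _ := by rw [e, ← hr, h (r x) x]
  have h3 : ‖v‖ ^ 3 ≤ ‖r x‖ ^ 3 * ‖r (S.t x x x)‖ * ‖v‖ := by
    rw [← S.norm_cube, h2]
    refine (S.norm_le _ _ _).trans ?_
    have := S.norm_le (r x) (r x) (r (S.t x x x))
    calc _ ≤ ‖r x‖ * (‖r x‖ * ‖r x‖ * ‖r (S.t x x x)‖) * ‖v‖ := by gcongr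
      _ = _ := by ring
  rcases (norm_nonneg (r x)).eq_or_lt with h0 | h0
  · rw [← h0]; simp
  have hp : 0 < ‖r x‖ ^ 3 := by positivity
  have hvp : 0 < ‖v‖ := hp.trans_le h1
  have h4 : ‖v‖ ^ 2 ≤ ‖r x‖ ^ 3 * ‖r (S.t x x x)‖ :=
    le_of_mul_le_mul_right (by rw [← pow_succ]; exact h3) hvp
  refine le_of_mul_le_mul_left (le_trans ?_ h4) hp
  rw [← pow_two]
  gcongr

/-- The Cayley transform of `x ↦ [x k k]`. -/
lemma exists_cayley [CompleteSpace Z] (S : CstarTernary Z) {k : Z} (hk : ‖k‖ < 1) :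
    ∃ u w : Z →L[ℂ] Z, S.CommutesLeft u ∧ S.IsAdjoint u w ∧
      (∀ x, ‖u x‖ ≤ ‖x‖) ∧ (∀ x, ‖w x‖ ≤ ‖x‖) ∧
      (∀ x, ∃ v, u x - x = S.t v k k) ∧
      (∀ x, ∃ v, ‖v‖ ≤ ‖x‖ ∧ u v - v = S.t x k k) := by
  set H := Complex.I • S.rightMul k with hH
  have hHn : ‖H‖ < 1 := by
    rw [hH, norm_smul, Complex.norm_I, one_mul]
    refine (S.norm_rightMul_le k).trans_lt ?_
    nlinarith [norm_nonneg k]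
  obtain ⟨A, hA⟩ := isUnit_one_sub_of_norm_lt_one hHn
  obtain ⟨B, hB⟩ := isUnit_one_sub_of_norm_lt_one (x := -H) (by rwa [norm_neg])
  have hHx (x : Z) : H x = Complex.I • S.t x k k := rfl
  have hAx (x : Z) : (A : Z →L[ℂ] Z) x = x - H x := by rw [hA]; rfl
  have hBx (x : Z) : (B : Z →L[ℂ] Z) x = x + H x := by rw [hB]; simp
  have hAA (x : Z) : (A : Z →L[ℂ] Z) ((↑A⁻¹ : Z →L[ℂ] Z) x) = x := by
    rw [← mul_apply_eq_comp, A.mul_inv]; rfl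
  have hBB (x : Z) : (B : Z →L[ℂ] Z) ((↑B⁻¹ : Z →L[ℂ] Z) x) = x := by
    rw [← mul_apply_eq_comp, B.mul_inv]; rfl
  have hA' (x : Z) : (↑A⁻¹ : Z →L[ℂ] Z) ((A : Z →L[ℂ] Z) x) = x := by
    rw [← mul_apply_eq_comp, A.inv_mul]; rfl
  have hHc (x y z : Z) : S.t x y (H z) = H (S.t x y z) := by
    rw [hHx, hHx, S.smul_right, S.assoc₂]
  have hAc : S.CommutesLeft (A : Z →L[ℂ] Z) := by
    intro x y z; rw [hAx, hAx, S.sub_right, hHc]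
  have hBc : S.CommutesLeft (B : Z →L[ℂ] Z) := by
    intro x y z; rw [hBx, hBx, S.add_right, hHc]
  have hAic : S.CommutesLeft (↑A⁻¹ : Z →L[ℂ] Z) := by
    intro x y z
    rw [← hA' (S.t x y _), ← hAc, hAA]
  have hHa (x y z : Z) : S.t x (H y) z = - S.t (H x) y z := by
    rw [hHx, hHx, S.smul_mid, S.smul_left, S.assoc₁]
    simp
  have hAB (a b z : Z) : S.t (B.1 a) (B.1 b) z = S.t (A.1 a) (A.1 b) z := by
    rw [hAx, hAx, hBx, hBx]
    simp only [S.add_left, S.add_mid, S.sub_left, S.sub_mid, hHa]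
    abel
  set u : Z →L[ℂ] Z := B.1 * (↑A⁻¹ : Z →L[ℂ] Z) with hu
  set w : Z →L[ℂ] Z := A.1 * (↑B⁻¹ : Z →L[ℂ] Z) with hw
  have hux (x : Z) : u x = B.1 ((↑A⁻¹ : Z →L[ℂ] Z) x) := rfl
  have hwx (x : Z) : w x = A.1 ((↑B⁻¹ : Z →L[ℂ] Z) x) := rfl
  have huA (x : Z) : u (A.1 x) = B.1 x := by rw [hux, hA']
  have huu (x y z : Z) : S.t (u x) (u y) z = S.t x y z := by
    rw [hux, hux, hAB, hAA, hAA]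
  have huw (x : Z) : u (w x) = x := by rw [hwx, huA, hBB]
  have hiso (x : Z) : ‖u x‖ = ‖x‖ := by
    have h1 : ‖u x‖ ^ 3 ≤ ‖x‖ * ‖x‖ * ‖u x‖ := by
      rw [← S.norm_cube, huu]; exact S.norm_le _ _ _
    have h2 : ‖x‖ ^ 3 ≤ ‖u x‖ * ‖u x‖ * ‖x‖ := by
      rw [← S.norm_cube, ← huu]; exact S.norm_le _ _ _
    have aux {a b : ℝ} (ha : 0 ≤ a) (hb : 0 ≤ b) (h : a ^ 3 ≤ b * b * a) : a ≤ b := by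
      by_contra! hab
      nlinarith [mul_pos (hb.trans_lt hab) (by nlinarith : 0 < a * a - b * b)]
    exact le_antisymm (aux (norm_nonneg _) (norm_nonneg _) h1)
      (aux (norm_nonneg _) (norm_nonneg _) h2)
  refine ⟨u, w, ?_, ?_, fun x => (hiso x).le, ?_, ?_, ?_⟩
  · intro x y z
    rw [hux, hBc, hAic, ← hux]
  · intro x y z
    rw [← huu (w x), huw]
  · intro x
    rw [← hiso (w x), huw]
  · intro x
    refine ⟨(2 * Complex.I) • (↑A⁻¹ : Z →L[ℂ] Z) x, ?_⟩
    nth_rw 2 [← hAA x]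
    rw [hux, hBx, hAx, S.smul_left, hHx, two_mul, add_smul]
    abel
  · intro x
    refine ⟨(2 * Complex.I)⁻¹ • A.1 x, ?_, ?_⟩
    · rw [norm_smul, hAx]
      have h1 : ‖x - H x‖ ≤ 2 * ‖x‖ := by
        have := norm_sub_le x (H x)
        have := H.le_of_opNorm_le hHn.le x
        linarith
      have h2 : ‖(2 * Complex.I)⁻¹‖ = 2⁻¹ := by simp
      rw [h2]
      linarith
    · rw [map_smul, huA, ← smul_sub, hBx, hAx, hHx]
      have : x + Complex.I • S.t x k k - (x - Complex.I • S.t x k k)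
          = (2 * Complex.I) • S.t x k k := by
        rw [two_mul, add_smul]; abel
      rw [this, smul_smul, inv_mul_cancel₀ (by simp), one_smul]

lemma norm_pow_apply_le {u : Z →L[ℂ] Z} (hu : ∀ x, ‖u x‖ ≤ ‖x‖) (n : ℕ) (x : Z) :
    ‖(u ^ n) x‖ ≤ ‖x‖ := by
  induction n with
  | zero => simp
  | succ n ih =>
    rw [pow_succ', mul_apply_eq_comp]
    exact (hu _).trans ih

lemma norm_average_le {u : Z →L[ℂ] Z} (hu : ∀ x, ‖u x‖ ≤ ‖x‖) {n : ℕ} (hn : 0 < n) (x : Z) :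
    ‖((n : ℂ)⁻¹ • ∑ j ∈ Finset.range n, u ^ j) x‖ ≤ ‖x‖ := by
  rw [smul_apply, sum_apply, norm_smul, norm_inv,
    Complex.norm_natCast, inv_mul_le_iff₀ (by positivity)]
  refine (norm_sum_le _ _).trans ?_
  refine (Finset.sum_le_sum fun j _ => norm_pow_apply_le hu j x).trans ?_
  simp

/-- Adjointable contractions which are the identity modulo `J` and make a given `k ∈ J` small. -/
lemma exists_small_of_norm_lt_one [CompleteSpace Z] (S : CstarTernary Z) {J : Submodule ℂ Z}
    (hideal : ∀ x y z : Z, (x ∈ J ∨ y ∈ J ∨ z ∈ J) → S.t x y z ∈ J)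
    {k : Z} (hkJ : k ∈ J) (hk : ‖k‖ < 1) {n : ℕ} (hn : 0 < n) :
    ∃ r s : Z →L[ℂ] Z, S.CommutesLeft r ∧ S.IsAdjoint r s ∧ (∀ x, ‖r x‖ ≤ ‖x‖) ∧
      (∀ x, r x - x ∈ J) ∧ ‖r k‖ ^ 3 ≤ 2 / n := by
  obtain ⟨u, w, huc, huw, hun, hwn, huJ, hsurj⟩ := S.exists_cayley hk
  have hn0 : (n : ℂ) ≠ 0 := by exact_mod_cast hn.ne'
  set r : Z →L[ℂ] Z := (n : ℂ)⁻¹ • ∑ j ∈ Finset.range n, u ^ j with hr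
  set s : Z →L[ℂ] Z := (n : ℂ)⁻¹ • ∑ j ∈ Finset.range n, w ^ j with hs
  have hrc : S.CommutesLeft r := (huc.sum_pow n).smul _
  have hrs : S.IsAdjoint r s := by simpa using (huw.sum_pow n).smul (n : ℂ)⁻¹
  have hrn : ∀ x, ‖r x‖ ≤ ‖x‖ := norm_average_le hun hn
  have hsn : ∀ x, ‖s x‖ ≤ ‖x‖ := norm_average_le hwn hn
  refine ⟨r, s, hrc, hrs, hrn, ?_, ?_⟩
  · have hu1 (x : Z) : u x - x ∈ J := by
      obtain ⟨v, hv⟩ := huJ x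
      rw [hv]; exact hideal _ _ _ (Or.inr (Or.inl hkJ))
    have hup (j : ℕ) (x : Z) : (u ^ j) x - x ∈ J := by
      induction j with
      | zero => simp
      | succ j ih =>
        rw [pow_succ', mul_apply_eq_comp]
        simpa using J.add_mem (hu1 ((u ^ j) x)) ih
    intro x
    have : r x - x = (n : ℂ)⁻¹ • ∑ j ∈ Finset.range n, ((u ^ j) x - x) := by
      rw [Finset.sum_sub_distrib, smul_sub, hr, smul_apply,
        sum_apply, Finset.sum_const, Finset.card_range,
        ← Nat.cast_smul_eq_nsmul ℂ, smul_smul, inv_mul_cancel₀ hn0, one_smul]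
    rw [this]
    exact J.smul_mem _ (J.sum_mem fun j _ => hup j x)
  · obtain ⟨v, hv, huv⟩ := hsurj (s (r k))
    have hvn : ‖v‖ ≤ 1 := hv.trans ((hsn _).trans ((hrn _).trans hk.le))
    have hgeom : r (u v - v) = (n : ℂ)⁻¹ • ((u ^ n) v - v) := by
      have := congrArg (fun T : Z →L[ℂ] Z => T v) (geom_sum_mul u n)
      simp only [mul_apply_eq_comp, sub_apply,
        one_apply_eq_self] at this
      rw [hr, smul_apply, this]
    rw [← S.norm_cube, hrc, hrs, ← huv, hgeom, norm_smul, norm_inv, Complex.norm_natCast,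
      div_eq_inv_mul]
    gcongr
    have h1 := norm_sub_le ((u ^ n) v) v
    have h2 := norm_pow_apply_le hun n v
    linarith

lemma exists_small [CompleteSpace Z] (S : CstarTernary Z) {J : Submodule ℂ Z}
    (hideal : ∀ x y z : Z, (x ∈ J ∨ y ∈ J ∨ z ∈ J) → S.t x y z ∈ J)
    {k : Z} (hkJ : k ∈ J) {ε : ℝ} (hε : 0 < ε) :
    ∃ r s : Z →L[ℂ] Z, S.CommutesLeft r ∧ S.IsAdjoint r s ∧ (∀ x, ‖r x‖ ≤ ‖x‖) ∧
      (∀ x, r x - x ∈ J) ∧ ‖r k‖ ≤ ε := by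
  set c : ℝ := ‖k‖ + 1 with hc
  have hc0 : 0 < c := by positivity
  have hcn : ‖(c : ℂ)⁻¹‖ = c⁻¹ := by
    rw [norm_inv, Complex.norm_real, Real.norm_of_nonneg hc0.le]
  have hδ : 0 < (c⁻¹ * ε) ^ 3 := by positivity
  obtain ⟨n, hn⟩ := exists_nat_gt (2 / (c⁻¹ * ε) ^ 3)
  have hn0 : (0 : ℝ) < n := lt_trans (by positivity) hn
  obtain ⟨r, s, h1, h2, h3, h4, h5⟩ := S.exists_small_of_norm_lt_one hideal
    (J.smul_mem (c : ℂ)⁻¹ hkJ)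
    (by rw [norm_smul, hcn, inv_mul_lt_iff₀ hc0]; linarith) (Nat.cast_pos.mp hn0)
  refine ⟨r, s, h1, h2, h3, h4, ?_⟩
  have h6 : (2 : ℝ) / n ≤ (c⁻¹ * ε) ^ 3 := by
    rw [div_le_iff₀ hn0]
    rw [div_lt_iff₀ hδ] at hn
    linarith
  have h7 := le_of_pow_le_pow_left₀ three_ne_zero (by positivity) (h5.trans h6)
  rw [map_smul, norm_smul, hcn] at h7
  exact le_of_mul_le_mul_left h7 (by positivity)

lemma norm_mk_cube_le [CompleteSpace Z] (S : CstarTernary Z) (J : Submodule ℂ Z)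
    (hideal : ∀ x y z : Z, (x ∈ J ∨ y ∈ J ∨ z ∈ J) → S.t x y z ∈ J) (x : Z) :
    ‖(Submodule.Quotient.mk x : Z ⧸ J)‖ ^ 3 ≤ ‖(Submodule.Quotient.mk (S.t x x x) : Z ⧸ J)‖ := by
  refine le_of_forall_pos_le_add fun ε hε => ?_
  obtain ⟨y, hy, hyn⟩ := Submodule.Quotient.norm_mk_lt
    (Submodule.Quotient.mk (S.t x x x) : Z ⧸ J) (half_pos hε)
  have hk : S.t x x x - y ∈ J := (Submodule.Quotient.eq J).mp hy.symm
  obtain ⟨r, s, hrc, hrs, hrn, hrJ, hrk⟩ := S.exists_small hideal hk (half_pos hε)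
  have h1 : ‖(Submodule.Quotient.mk x : Z ⧸ J)‖ ≤ ‖r x‖ := by
    rw [← (Submodule.Quotient.eq J).mpr (hrJ x)]
    exact Submodule.Quotient.norm_mk_le J _
  have h2 : r (S.t x x x) = r y + r (S.t x x x - y) := by rw [← map_add, add_sub_cancel]
  calc _ ≤ ‖r x‖ ^ 3 := by gcongr
    _ ≤ ‖r (S.t x x x)‖ := norm_cube_le hrc hrs hrn x
    _ ≤ ‖r y‖ + ‖r (S.t x x x - y)‖ := by rw [h2]; exact norm_add_le _ _
    _ ≤ _ := by linarith [hrn y]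

lemma mk_eq_mk (S : CstarTernary Z) (J : Submodule ℂ Z)
    (hideal : ∀ x y z : Z, (x ∈ J ∨ y ∈ J ∨ z ∈ J) → S.t x y z ∈ J) {x y z x' y' z' : Z}
    (hx : (Submodule.Quotient.mk x : Z ⧸ J) = Submodule.Quotient.mk x')
    (hy : (Submodule.Quotient.mk y : Z ⧸ J) = Submodule.Quotient.mk y')
    (hz : (Submodule.Quotient.mk z : Z ⧸ J) = Submodule.Quotient.mk z') :
    (Submodule.Quotient.mk (S.t x y z) : Z ⧸ J) = Submodule.Quotient.mk (S.t x' y' z') := by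
  rw [Submodule.Quotient.eq] at *
  have h : S.t x y z - S.t x' y' z'
      = S.t (x - x') y z + S.t x' (y - y') z + S.t x' y' (z - z') := by
    rw [S.sub_left, S.sub_mid, S.sub_right]; abel
  rw [h]
  exact J.add_mem (J.add_mem (hideal _ _ _ (Or.inl hx)) (hideal _ _ _ (Or.inr (Or.inl hy))))
    (hideal _ _ _ (Or.inr (Or.inr hz)))

lemma norm_mk_le (S : CstarTernary Z) (J : Submodule ℂ Z)
    (hideal : ∀ x y z : Z, (x ∈ J ∨ y ∈ J ∨ z ∈ J) → S.t x y z ∈ J) (x y z : Z) :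
    ‖(Submodule.Quotient.mk (S.t x y z) : Z ⧸ J)‖ ≤ ‖(Submodule.Quotient.mk x : Z ⧸ J)‖ *
      ‖(Submodule.Quotient.mk y : Z ⧸ J)‖ * ‖(Submodule.Quotient.mk z : Z ⧸ J)‖ := by
  set a : Z ⧸ J := Submodule.Quotient.mk x with ha
  set b : Z ⧸ J := Submodule.Quotient.mk y with hb
  set c : Z ⧸ J := Submodule.Quotient.mk z with hc
  have key (δ : ℝ) (hδ : 0 < δ) : ‖(Submodule.Quotient.mk (S.t x y z) : Z ⧸ J)‖ ≤
      (‖a‖ + δ) * (‖b‖ + δ) * (‖c‖ + δ) := by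
    obtain ⟨x', hx, hx'⟩ := Submodule.Quotient.norm_mk_lt a hδ
    obtain ⟨y', hy, hy'⟩ := Submodule.Quotient.norm_mk_lt b hδ
    obtain ⟨z', hz, hz'⟩ := Submodule.Quotient.norm_mk_lt c hδ
    rw [S.mk_eq_mk J hideal (ha.symm.trans hx.symm) (hb.symm.trans hy.symm)
      (hc.symm.trans hz.symm)]
    refine (Submodule.Quotient.norm_mk_le J _).trans ((S.norm_le _ _ _).trans ?_)
    gcongr
  have hlim : Filter.Tendsto (fun δ : ℝ => (‖a‖ + δ) * (‖b‖ + δ) * (‖c‖ + δ))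
      (nhdsWithin 0 (Set.Ioi 0)) (nhds (‖a‖ * ‖b‖ * ‖c‖)) := by
    have hcont : Continuous fun δ : ℝ => (‖a‖ + δ) * (‖b‖ + δ) * (‖c‖ + δ) := by fun_prop
    simpa using (hcont.tendsto 0).mono_left nhdsWithin_le_nhds
  exact ge_of_tendsto hlim (Filter.eventually_of_mem self_mem_nhdsWithin key)

end CstarTernary

/-- Let `Z` be a C*-ternary ring and `J ⊆ Z` a closed linear subspace which is a ternary
ideal, i.e. `[x y z] ∈ J` whenever at least one of `x, y, z` lies in `J`.  Then the
quotient Banach space `Z/J` carries a well-defined triple product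
`[x+J, y+J, z+J] = [x y z] + J`, and with this product and the quotient norm `Z/J` is
again a C*-ternary ring; in particular `‖[x̄ ȳ z̄]‖ ≤ ‖x̄‖‖ȳ‖‖z̄‖` and
`‖[x̄ x̄ x̄]‖ = ‖x̄‖³`. -/
theorem cstarTernary_quotient
    {Z : Type*} [NormedAddCommGroup Z] [NormedSpace ℂ Z] [CompleteSpace Z]
    (S : CstarTernary Z) (J : Submodule ℂ Z) [IsClosed (J : Set Z)]
    (hideal : ∀ x y z : Z, (x ∈ J ∨ y ∈ J ∨ z ∈ J) → S.t x y z ∈ J) :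
    ∃ tq : (Z ⧸ J) → (Z ⧸ J) → (Z ⧸ J) → (Z ⧸ J),
      (∀ x y z : Z,
        tq (Submodule.Quotient.mk x) (Submodule.Quotient.mk y) (Submodule.Quotient.mk z)
          = Submodule.Quotient.mk (S.t x y z)) ∧
      (∀ a d b c : Z ⧸ J, tq (a + d) b c = tq a b c + tq d b c) ∧
      (∀ (μ : ℂ) (a b c : Z ⧸ J), tq (μ • a) b c = μ • tq a b c) ∧
      (∀ a b d c : Z ⧸ J, tq a (b + d) c = tq a b c + tq a d c) ∧
      (∀ (μ : ℂ) (a b c : Z ⧸ J), tq a (μ • b) c = (starRingEnd ℂ) μ • tq a b c) ∧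
      (∀ a b c d : Z ⧸ J, tq a b (c + d) = tq a b c + tq a b d) ∧
      (∀ (μ : ℂ) (a b c : Z ⧸ J), tq a b (μ • c) = μ • tq a b c) ∧
      (∀ v w x y z : Z ⧸ J, tq (tq v w x) y z = tq v (tq y x w) z) ∧
      (∀ v w x y z : Z ⧸ J, tq (tq v w x) y z = tq v w (tq x y z)) ∧
      (∀ a b c : Z ⧸ J, ‖tq a b c‖ ≤ ‖a‖ * ‖b‖ * ‖c‖) ∧
      (∀ a : Z ⧸ J, ‖tq a a a‖ = ‖a‖ ^ 3) := by
  have hmk : ∀ a : Z ⧸ J, ∃ x, Submodule.Quotient.mk x = a :=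
    Submodule.Quotient.mk_surjective J
  choose f hf using hmk
  have htq (x y z : Z) : (Submodule.Quotient.mk (S.t (f (Submodule.Quotient.mk x))
      (f (Submodule.Quotient.mk y)) (f (Submodule.Quotient.mk z))) : Z ⧸ J)
        = Submodule.Quotient.mk (S.t x y z) :=
    S.mk_eq_mk J hideal (hf _) (hf _) (hf _)
  generalize htqd : (fun a b c : Z ⧸ J =>
    (Submodule.Quotient.mk (S.t (f a) (f b) (f c)) : Z ⧸ J)) = tq
  have hq (x y z : Z) : tq (Submodule.Quotient.mk x) (Submodule.Quotient.mk y)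
      (Submodule.Quotient.mk z) = Submodule.Quotient.mk (S.t x y z) := by
    rw [← htqd]; exact htq x y z
  have ind : ∀ {p : Z ⧸ J → Prop}, (∀ x, p (Submodule.Quotient.mk x)) → ∀ a, p a :=
    fun h a => hf a ▸ h (f a)
  refine ⟨tq, hq, ?_, ?_, ?_, ?_, ?_, ?_, ?_, ?_, ?_, ?_⟩
  · refine ind fun a => ind fun d => ind fun b => ind fun c => ?_
    simp only [hq, ← Submodule.Quotient.mk_add, S.add_left]
  · intro μ
    refine ind fun a => ind fun b => ind fun c => ?_
    simp only [hq, ← Submodule.Quotient.mk_smul, S.smul_left]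
  · refine ind fun a => ind fun b => ind fun d => ind fun c => ?_
    simp only [hq, ← Submodule.Quotient.mk_add, S.add_mid]
  · intro μ
    refine ind fun a => ind fun b => ind fun c => ?_
    simp only [hq, ← Submodule.Quotient.mk_smul, S.smul_mid]
  · refine ind fun a => ind fun b => ind fun c => ind fun d => ?_
    simp only [hq, ← Submodule.Quotient.mk_add, S.add_right]
  · intro μ
    refine ind fun a => ind fun b => ind fun c => ?_
    simp only [hq, ← Submodule.Quotient.mk_smul, S.smul_right]
  · refine ind fun v => ind fun w => ind fun x => ind fun y => ind fun z => ?_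
    simp only [hq]
    rw [S.assoc₁]
  · refine ind fun v => ind fun w => ind fun x => ind fun y => ind fun z => ?_
    simp only [hq]
    rw [S.assoc₂]
  · refine ind fun a => ind fun b => ind fun c => ?_
    rw [hq]
    exact S.norm_mk_le J hideal a b c
  · refine ind fun a => ?_
    rw [hq]
    refine le_antisymm ((S.norm_mk_le J hideal a a a).trans_eq (by ring)) ?_
    exact S.norm_mk_cube_le J hideal a
end
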